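/- Let n ≥ 1, let α_0, α_1, …, α_n be non-negative constants with at least two of them positive, and let c > 0 be a constant. If 0 < u ∈ C²(𝕊ⁿ) is an even, convex function satisfying Σ_k α_k σ_k(∇̄²u + ḡ u, ḡ) = c on 𝕊ⁿ, then u is constant (equivalently, the only even, smooth, convex bodies whose associated kinematic measure density Σ_k α_k σ_k is a positive constant are origin-centred balls). -/

import Mathlib

/-!
We work with the unit sphere `𝕊ⁿ = sphere 0 1 ⊆ ℝ^{n+1}`.  A `C²` function `u` on `𝕊ⁿ` is
represented by its positively 1-homogeneous extension `u : ℝ^{n+1} → ℝ` (which is `C²` away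
from the origin).  For such an extension, the ambient Euclidean Hessian `D²u(x)` at a point
`x ∈ 𝕊ⁿ` annihilates the radial direction `x` and its restriction to the tangent space
`x^⊥ = T_x𝕊ⁿ` coincides with the spherical bilinear form `∇̄²u + ḡ u`.  Consequently:

* the eigenvalues of `∇̄²u + ḡ u` w.r.t. `ḡ` are the eigenvalues of the ambient Hessian
  matrix other than the trivial zero radial one, so for `0 ≤ k ≤ n` the elementary symmetric
  function `σ_k(∇̄²u + ḡ u, ḡ)` equals the `k`-th elementary symmetric function of all the
  eigenvalues of the ambient Hessian matrix, which is `(-1)^k` times the coefficient of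
  `t^{n+1-k}` in its characteristic polynomial (`sigmaElem` below);
* the spherical gradient `Du(x)` is the tangential part `∇u(x) - u(x)x` of the ambient
  gradient (`sphGrad` below);
* `u` is convex (resp. the hypersurface with support function `u` is strictly convex) iff the
  Hessian form is positive semidefinite (resp. positive definite on `x^⊥`) at every `x ∈ 𝕊ⁿ`.

The spherical Lebesgue measure `μ` is the `n`-dimensional Hausdorff measure `μH[n]`.
-/

open MeasureTheory Metric
open scoped RealInnerProductSpace

noncomputable section

/-- The ambient Euclidean space `ℝ^{n+1}`. -/
abbrev Esp (n : ℕ) := EuclideanSpace ℝ (Fin (n + 1))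

/-- The ambient Hessian bilinear form `D²u(x)(v,w)` of `u : ℝ^{n+1} → ℝ`. -/
def hessForm (n : ℕ) (u : Esp n → ℝ) (x v w : Esp n) : ℝ :=
  fderiv ℝ (fun y => fderiv ℝ u y w) x v

/-- The ambient Hessian matrix of `u` at `x` in the standard orthonormal coordinates. -/
def hessMatrix (n : ℕ) (u : Esp n → ℝ) (x : Esp n) : Matrix (Fin (n + 1)) (Fin (n + 1)) ℝ :=
  Matrix.of fun i j => hessForm n u x (EuclideanSpace.single i 1) (EuclideanSpace.single j 1)

/-- For a positively 1-homogeneous `u` and `x ∈ 𝕊ⁿ`, `k ≤ n`, this is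
`σ_k(∇̄²u + ḡ u, ḡ)(x)`, the `k`-th elementary symmetric function of the eigenvalues of
`∇̄²u + ḡ u` w.r.t. `ḡ`, computed from the characteristic polynomial of the ambient Hessian. -/
def sigmaElem (n k : ℕ) (u : Esp n → ℝ) (x : Esp n) : ℝ :=
  (-1 : ℝ) ^ k * ((hessMatrix n u x).charpoly.coeff (n + 1 - k))

/-- The spherical gradient `Du(x)` at `x ∈ 𝕊ⁿ`: the tangential part of the ambient gradient. -/
def sphGrad (n : ℕ) (u : Esp n → ℝ) (x : Esp n) : Esp n :=
  gradient u x - u x • x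

/-- `u` is positively 1-homogeneous (i.e. it is the canonical extension of `u|_{𝕊ⁿ}`). -/
def PosHom (n : ℕ) (u : Esp n → ℝ) : Prop :=
  ∀ r : ℝ, 0 < r → ∀ x : Esp n, u (r • x) = r * u x

/-- The spherical Lebesgue measure on `ℝ^{n+1}` (to be restricted to `𝕊ⁿ`):
the `n`-dimensional Hausdorff measure. -/
def sphMeasure (n : ℕ) : Measure (Esp n) := μH[(n : ℝ)]


section part1
/-! ### Newton's inequalities -/

/-- Normalised log-concave sequences. -/
def NewtonSeq (p : ℕ → ℝ) : Prop :=
  p 0 = 1 ∧ (∀ k, 0 ≤ p k) ∧ ∀ i j, i ≤ j → p i * p (j + 1) ≤ p (i + 1) * p j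

lemma esymm_cons_succ (x : ℝ) (s : Multiset ℝ) (k : ℕ) :
    (x ::ₘ s).esymm (k + 1) = s.esymm (k + 1) + x * s.esymm k := by
  simp [Multiset.esymm, Multiset.powersetCard_cons, Multiset.map_map,
    Multiset.sum_map_mul_left]

lemma esymm_zero' (s : Multiset ℝ) : s.esymm 0 = 1 := by
  simp [Multiset.esymm]

lemma esymm_of_card_lt (s : Multiset ℝ) (k : ℕ) (h : s.card < k) : s.esymm k = 0 := by
  simp [Multiset.esymm, Multiset.powersetCard_eq_empty _ h]

/-- normalised elementary symmetric functions -/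
noncomputable def pnorm (s : Multiset ℝ) (k : ℕ) : ℝ := s.esymm k / (s.card.choose k : ℝ)

lemma pnorm_zero (s : Multiset ℝ) : pnorm s 0 = 1 := by
  simp [pnorm, esymm_zero']

lemma pnorm_of_lt (s : Multiset ℝ) (k : ℕ) (h : s.card < k) : pnorm s k = 0 := by
  simp [pnorm, esymm_of_card_lt s k h]

lemma pnorm_cons (x : ℝ) (s : Multiset ℝ) (k : ℕ) (hk : k ≤ s.card) :
    ((s.card : ℝ) + 1) * pnorm (x ::ₘ s) (k + 1) =
      ((s.card : ℝ) - k) * pnorm s (k + 1) + (k + 1) * x * pnorm s k := by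
  set n := s.card with hn
  have h1 : ((n + 1).choose (k + 1) : ℝ) ≠ 0 := by
    exact_mod_cast (Nat.choose_pos (by omega)).ne'
  have h2 : (n.choose k : ℝ) ≠ 0 := by exact_mod_cast (Nat.choose_pos hk).ne'
  have e1 : ((n : ℝ) + 1) * n.choose k = (n + 1).choose (k + 1) * (k + 1) := by
    exact_mod_cast Nat.add_one_mul_choose_eq n k
  have hb : pnorm (x ::ₘ s) (k + 1) =
    (s.esymm (k + 1) + x * s.esymm k) / ((n + 1).choose (k + 1) : ℝ) := by
    simp [pnorm, esymm_cons_succ, hn]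
  rw [hb]
  have hA : pnorm s k = s.esymm k / (n.choose k : ℝ) := rfl
  rcases hk.eq_or_lt with hk' | hk'
  · rw [hA, esymm_of_card_lt s (k + 1) (by omega), hk']
    simp
    field_simp
  · have h3 : (n.choose (k + 1) : ℝ) ≠ 0 := by exact_mod_cast (Nat.choose_pos hk').ne'
    have e2 : (n.choose (k + 1) : ℝ) * (k + 1) = n.choose k * ((n : ℝ) - k) := by
      have := Nat.choose_succ_right_eq n k
      rw [← Nat.cast_sub hk]
      exact_mod_cast this
    have hB : pnorm s (k + 1) = s.esymm (k + 1) / (n.choose (k + 1) : ℝ) := rfl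
    rw [hA, hB]
    have hk1 : ((k : ℝ) + 1) ≠ 0 := by positivity
    have e3 : ((n + 1).choose (k + 1) : ℝ) = ((n : ℝ) + 1) * n.choose k / (k + 1) := by
      field_simp; linarith
    have e4 : (n.choose (k + 1) : ℝ) = n.choose k * ((n : ℝ) - k) / (k + 1) := by
      field_simp; linarith
    have hnk : ((n : ℝ) - k) ≠ 0 := by
      have : (k : ℝ) < n := by exact_mod_cast hk'
      linarith
    have hn1 : ((n : ℝ) + 1) ≠ 0 := by positivity
    rw [e3, e4]
    field_simp

lemma pnorm_aux (s : Multiset ℝ) (hs : ∀ x ∈ s, 0 ≤ x) :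
    (∀ k, 0 ≤ pnorm s k) ∧ (∀ k, pnorm s k = 0 → pnorm s (k + 1) = 0) ∧
    (∀ k, pnorm s k * pnorm s (k + 2) ≤ pnorm s (k + 1) ^ 2) := by
  induction s using Multiset.induction with
  | empty =>
    have h : ∀ k, pnorm (0 : Multiset ℝ) (k + 1) = 0 := fun k => pnorm_of_lt _ _ (by simp)
    refine ⟨?_, fun k _ => h k, fun k => ?_⟩
    · rintro (_ | k)
      · simp [pnorm_zero]
      · simp [h]
    · rw [h (k + 1), h k]; simp
  | cons x s ih =>
    obtain ⟨i1, i2, i3⟩ := ih (fun y hy => hs y (Multiset.mem_cons_of_mem hy))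
    have hx : 0 ≤ x := hs x (Multiset.mem_cons_self x s)
    have hn1 : (0 : ℝ) < (s.card : ℝ) + 1 := by positivity
    have hc := pnorm_cons x s
    have hbig : ∀ k, s.card + 1 < k → pnorm (x ::ₘ s) k = 0 := fun k hk =>
      pnorm_of_lt _ _ (by simpa using hk)
    refine ⟨?_, ?_, ?_⟩
    · rintro (_ | k)
      · simp [pnorm_zero]
      · by_cases hk : k ≤ s.card
        · have := hc k hk
          have hkn : (k : ℝ) ≤ s.card := by exact_mod_cast hk
          have h5 : 0 ≤ ((s.card : ℝ) + 1) * pnorm (x ::ₘ s) (k + 1) := by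
            rw [this]
            have := i1 (k + 1); have := i1 k
            have : 0 ≤ (s.card : ℝ) - k := by linarith
            positivity
          exact nonneg_of_mul_nonneg_right h5 hn1
        · exact (hbig _ (by omega)).ge
    · rintro (_ | k) h0
      · simp [pnorm_zero] at h0
      · by_cases hk : k + 1 ≤ s.card
        · have e1 := hc k (by omega)
          have e2 := hc (k + 1) hk
          have hkn : (k : ℝ) + 1 ≤ s.card := by exact_mod_cast hk
          rw [h0, mul_zero] at e1
          have p1 : 0 ≤ ((s.card : ℝ) - k) * pnorm s (k + 1) :=
            mul_nonneg (by linarith) (i1 _)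
          have p2 : 0 ≤ (k + 1) * x * pnorm s k :=
            mul_nonneg (by positivity) (i1 _)
          have p3 : ((s.card : ℝ) - k) * pnorm s (k + 1) = 0 := by linarith
          have p4 : pnorm s (k + 1) = 0 := by
            rcases mul_eq_zero.1 p3 with h | h
            · linarith
            · exact h
          rw [i2 _ p4, p4] at e2
          simp only [mul_zero, add_zero] at e2
          exact (mul_eq_zero.1 e2).resolve_left hn1.ne'
        · exact hbig _ (by omega)
    · intro k
      by_cases hk : k + 1 ≤ s.card
      · suffices H : (((s.card : ℝ) + 1) * pnorm (x ::ₘ s) k) *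
            (((s.card : ℝ) + 1) * pnorm (x ::ₘ s) (k + 2)) ≤
            (((s.card : ℝ) + 1) * pnorm (x ::ₘ s) (k + 1)) ^ 2 by
          have : ((s.card : ℝ) + 1) ^ 2 * (pnorm (x ::ₘ s) k * pnorm (x ::ₘ s) (k + 2)) ≤
            ((s.card : ℝ) + 1) ^ 2 * (pnorm (x ::ₘ s) (k + 1)) ^ 2 := by nlinarith
          exact le_of_mul_le_mul_left this (by positivity)
        rcases k with _ | m
        · have e1 := hc 0 (by omega)
          have e2 := hc 1 (by omega)
          rw [e1, e2, pnorm_zero, pnorm_zero]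
          have := i3 0
          simp only [zero_add, pnorm_zero] at this ⊢
          have hn : (1 : ℝ) ≤ s.card := by exact_mod_cast hk
          set n : ℝ := (s.card : ℝ)
          push_cast
          nlinarith [sq_nonneg (pnorm s 1 - x), mul_nonneg (mul_nonneg (by linarith : 0 ≤ n - 1) (by linarith : 0 ≤ n + 1)) (sub_nonneg.2 this)]
        · have e0 := hc m (by omega)
          have e1 := hc (m + 1) (by omega)
          have e2 := hc (m + 2) (by omega)
          rw [e0, e1, e2]
          have q1 := i3 m
          have q2 := i3 (m + 1)
          have hn : (m : ℝ) + 2 ≤ s.card := by exact_mod_cast hk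
          have z1 := i2 (m + 1)
          have z2 := i2 (m + 2)
          have b0 := i1 m
          have b1 := i1 (m + 1)
          have b2 := i1 (m + 2)
          have b3 := i1 (m + 3)
          simp only [add_assoc, Nat.reduceAdd] at *
          generalize pnorm s m = A at *
          generalize pnorm s (m + 1) = B at *
          generalize pnorm s (m + 2) = C at *
          generalize pnorm s (m + 3) = D at *
          have q3 : A * D ≤ B * C := by
            rcases b1.eq_or_lt with h | h
            · rw [z2 (z1 h.symm)]; simp; positivity
            rcases b2.eq_or_lt with h' | h'
            · rw [z2 h'.symm]; simp; positivity
            have : (B * C) * (A * D) ≤ (B * C) * (B * C) := by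
              have := mul_le_mul q1 q2 (by positivity) (by positivity)
              nlinarith
            exact le_of_mul_le_mul_left this (by positivity)
          obtain ⟨a, ha⟩ : ∃ a : ℝ, (s.card : ℝ) = a + m + 1 := ⟨s.card - m - 1, by ring⟩
          have ha1 : 1 ≤ a := by linarith
          rw [ha]
          push_cast
          have hm : (0 : ℝ) ≤ m := by positivity
          have t1 : 0 ≤ (a - 1) * (a + 1) * (C ^ 2 - B * D) :=
            mul_nonneg (mul_nonneg (by linarith) (by linarith)) (by linarith)
          have t2 : 0 ≤ x ^ 2 * (((m : ℝ) + 1) * (m + 3)) * (B ^ 2 - A * C) :=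
            mul_nonneg (by positivity) (by linarith)
          have t3 : 0 ≤ x * (((m : ℝ) + 1) * (a - 1)) * (B * C - A * D) :=
            mul_nonneg (mul_nonneg hx (mul_nonneg (by linarith) (by linarith))) (by linarith)
          nlinarith [sq_nonneg (C - x * B)]
      · rw [hbig (k + 2) (by omega)]; simp; positivity

lemma pnorm_newtonSeq (s : Multiset ℝ) (hs : ∀ x ∈ s, 0 ≤ x) : NewtonSeq (pnorm s) := by
  obtain ⟨i1, i2, i3⟩ := pnorm_aux s hs
  refine ⟨pnorm_zero s, i1, ?_⟩
  intro i j hij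
  induction j, hij using Nat.le_induction with
  | base => rw [mul_comm]
  | succ j hij ih =>
    have b0 := i1 i
    have b1 := i1 (i + 1)
    rcases (i1 (j + 1)).eq_or_lt with h | h
    · rw [i2 _ h.symm]; simp; rw [← h]; simp
    have hj : 0 < pnorm s j := by
      rcases (i1 j).eq_or_lt with h' | h'
      · exact absurd (i2 _ h'.symm) h.ne'
      · exact h'
    have q := i3 j
    have b2 := i1 (j + 2)
    have : (pnorm s j * pnorm s (j + 1)) * (pnorm s i * pnorm s (j + 2)) ≤
        (pnorm s j * pnorm s (j + 1)) * (pnorm s (i + 1) * pnorm s (j + 1)) := by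
      have := mul_le_mul ih q (by positivity) (by positivity)
      nlinarith
    exact le_of_mul_le_mul_left this (by positivity)

lemma newton_step {p : ℕ → ℝ} (hp : NewtonSeq p) (k : ℕ) : p (k + 1) ≤ p k * p 1 := by
  have := hp.2.2 0 k (Nat.zero_le _)
  rw [hp.1] at this
  simp at this
  linarith

lemma newton_pow {p : ℕ → ℝ} (hp : NewtonSeq p) (k : ℕ) : p k ≤ p 1 ^ k := by
  induction k with
  | zero => simp [hp.1]
  | succ k ih =>
    calc _ ≤ p k * p 1 := newton_step hp k
      _ ≤ p 1 ^ k * p 1 := mul_le_mul_of_nonneg_right ih (hp.2.1 1)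
      _ = _ := by ring

lemma newton_one_ge {p a : ℕ → ℝ} (hp : NewtonSeq p) (ha : ∀ k, 0 ≤ a k) {j : ℕ} (hj : 1 ≤ j)
    (haj : 0 < a j) {r : ℝ} (hr : 0 < r)
    (h : ∑ k ∈ Finset.range (j + 1), a k * p k = ∑ k ∈ Finset.range (j + 1), a k * r ^ k) :
    r ≤ p 1 := by
  by_contra! hlt
  refine absurd h (ne_of_lt ?_)
  have hb : ∀ k, p k ≤ r ^ k := fun k => (newton_pow hp k).trans
    (pow_le_pow_left₀ (hp.2.1 1) hlt.le k)
  refine Finset.sum_lt_sum (fun k _ => mul_le_mul_of_nonneg_left (hb k) (ha k))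
    ⟨j, by simp, mul_lt_mul_of_pos_left ?_ haj⟩
  exact (newton_pow hp j).trans_lt (pow_lt_pow_left₀ hlt (hp.2.1 1) (by omega))

lemma newton_top_le {p a : ℕ → ℝ} (hp : NewtonSeq p) (ha : ∀ k, 0 ≤ a k) {j : ℕ}
    (haj : 0 < a (j + 1)) {r : ℝ} (hr : 0 < r)
    (h : ∑ k ∈ Finset.range (j + 2), a k * p k = ∑ k ∈ Finset.range (j + 2), a k * r ^ k) :
    p (j + 1) ≤ r * p j := by
  by_contra! hlt
  refine absurd h.symm (ne_of_lt ?_)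
  have hstep : ∀ k, k ≤ j → r * p k ≤ p (k + 1) ∧ (0 < p k → r * p k < p (k + 1)) := by
    intro k hk
    have h1 := hp.2.2 k j hk
    have hpj : 0 ≤ p j := hp.2.1 j
    rcases hpj.eq_or_lt with h0 | h0
    · rw [← h0] at h1 hlt
      have : 0 < p (j + 1) := by simpa using hlt
      have h3 : p k = 0 := by
        have := hp.2.1 k
        by_contra hne
        have : 0 < p k := lt_of_le_of_ne this (Ne.symm hne)
        have : 0 < p k * p (j + 1) := by positivity
        linarith
      rw [h3]; simp; exact hp.2.1 _
    · have h4 : p k * (r * p j) ≤ p (k + 1) * p j :=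
        (mul_le_mul_of_nonneg_left hlt.le (hp.2.1 k)).trans h1
      refine ⟨le_of_mul_le_mul_right (by linarith) h0, fun hpk => ?_⟩
      have : p k * (r * p j) < p k * p (j + 1) := mul_lt_mul_of_pos_left hlt hpk
      exact lt_of_mul_lt_mul_right (by linarith : r * p k * p j < p (k + 1) * p j) h0.le
  have hb : ∀ k, k ≤ j + 1 → r ^ k ≤ p k := by
    intro k
    induction k with
    | zero => intro _; simp [hp.1]
    | succ k ih =>
      intro hk
      calc r ^ (k + 1) = r * r ^ k := by ring
        _ ≤ r * p k := mul_le_mul_of_nonneg_left (ih (by omega)) hr.le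
        _ ≤ _ := (hstep k (by omega)).1
  refine Finset.sum_lt_sum (fun k hk => mul_le_mul_of_nonneg_left (hb k ?_) (ha k))
    ⟨j + 1, by simp, mul_lt_mul_of_pos_left ?_ haj⟩
  · simp at hk; omega
  · have hpj : 0 < p j := (pow_pos hr j).trans_le (hb j (by omega))
    calc r ^ (j + 1) = r * r ^ j := by ring
      _ ≤ r * p j := mul_le_mul_of_nonneg_left (hb j (by omega)) hr.le
      _ < _ := (hstep j le_rfl).2 hpj

lemma newton_top_eq {p a : ℕ → ℝ} (hp : NewtonSeq p) (ha : ∀ k, 0 ≤ a k) {j : ℕ}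
    (haj : 0 < a j) {r : ℝ}
    (h : ∑ k ∈ Finset.range (j + 1), a k * p k = ∑ k ∈ Finset.range (j + 1), a k * r ^ k)
    (h1 : p 1 = r) : p j = r ^ j := by
  have hb : ∀ k, p k ≤ r ^ k := fun k => h1 ▸ newton_pow hp k
  have := (Finset.sum_eq_sum_iff_of_le
    (fun k _ => mul_le_mul_of_nonneg_left (hb k) (ha k))).1 h j (by simp)
  exact mul_left_cancel₀ haj.ne' this

end part1

section part2
open Polynomial in
/-- elementary symmetric functions of a matrix -/
noncomputable def sigM {n : ℕ} (M : Matrix (Fin (n + 1)) (Fin (n + 1)) ℝ) (k : ℕ) : ℝ :=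
  (-1 : ℝ) ^ k * (M.charpoly.coeff (n + 1 - k))

lemma det_one_add_eq_sum_sigM {n : ℕ} (M : Matrix (Fin (n + 1)) (Fin (n + 1)) ℝ) (t : ℝ) :
    (1 + t • M).det = ∑ k ∈ Finset.range (n + 2), t ^ k * sigM M k := by
  have h1 : (1 + t • M).det = M.charpolyRev.eval (-t) := by
    rw [Matrix.charpolyRev, ← Polynomial.coe_evalRingHom, RingHom.map_det]
    congr 1
    ext i j
    by_cases hij : i = j
    · subst hij
      simp; ring
    · simp [hij]; ring
  rw [h1, ← Matrix.reverse_charpoly, Polynomial.eval_eq_sum_range' (n := n + 2)]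
  · refine Finset.sum_congr rfl fun k hk => ?_
    have hk' : k ≤ n + 1 := by simp at hk; omega
    rw [Polynomial.coeff_reverse, Matrix.charpoly_natDegree_eq_dim, Polynomial.revAt_le (by simpa using hk'),
      Fintype.card_fin, sigM, neg_pow]
    ring
  · have := Polynomial.reverse_natDegree_le M.charpoly
    rw [Matrix.charpoly_natDegree_eq_dim, Fintype.card_fin] at this
    omega

lemma multiset_sq (s : Multiset ℝ) :
    s.sum ^ 2 = (s.map (fun x => x ^ 2)).sum + 2 * s.esymm 2 := by
  induction s using Multiset.induction with
  | empty => rw [esymm_of_card_lt _ _ (by simp)]; simp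
  | cons x s ih =>
    rw [esymm_cons_succ]
    have h1 : s.esymm 1 = s.sum := by simp [Multiset.esymm, Multiset.powersetCard_one]
    simp only [Multiset.sum_cons, Multiset.map_cons, h1]
    nlinarith

lemma sigM_eq_esymm_roots {n : ℕ} {M : Matrix (Fin (n + 1)) (Fin (n + 1)) ℝ} (hM : M.IsHermitian)
    (k : ℕ) (hk : k ≤ n + 1) : sigM M k = M.charpoly.roots.esymm k := by
  have hd : M.charpoly.natDegree = n + 1 := by simp
  rw [sigM, Polynomial.coeff_eq_esymm_roots_of_splits hM.splits_charpoly (by rw [hd]; omega), hd,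
    (Matrix.charpoly_monic M).leadingCoeff, Nat.sub_sub_self hk, one_mul, ← mul_assoc, ← mul_pow]
  simp

lemma sigM_one {n : ℕ} (M : Matrix (Fin (n + 1)) (Fin (n + 1)) ℝ) : sigM M 1 = M.trace := by
  rw [Matrix.trace_eq_neg_charpoly_coeff]; simp [sigM]

lemma trace_sq_eq {n : ℕ} {M : Matrix (Fin (n + 1)) (Fin (n + 1)) ℝ} (hM : M.IsHermitian) :
    (M * M).trace = (M.charpoly.roots.map (fun x => x ^ 2)).sum := by
  rw [hM.roots_charpoly_eq_eigenvalues]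
  have h := hM.spectral_theorem
  conv_lhs => rw [h, ← map_mul, Matrix.diagonal_mul_diagonal, Unitary.conjStarAlgAut_apply,
    Matrix.trace_mul_comm, ← mul_assoc]
  simp [Matrix.trace, Finset.sum, Function.comp_def, sq]

lemma two_sigM_two {n : ℕ} (hn : 1 ≤ n) {M : Matrix (Fin (n + 1)) (Fin (n + 1)) ℝ}
    (hM : M.IsHermitian) : 2 * sigM M 2 = M.trace ^ 2 - (M * M).trace := by
  rw [sigM_eq_esymm_roots hM 2 (by omega), trace_sq_eq hM,
    Matrix.trace_eq_sum_roots_charpoly_of_splits hM.splits_charpoly, multiset_sq]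
  ring

lemma sigM_multiset {n : ℕ} {M : Matrix (Fin (n + 1)) (Fin (n + 1)) ℝ} (hM : M.PosSemidef)
    (hdet : M.det = 0) : ∃ s : Multiset ℝ, s.card = n ∧ (∀ x ∈ s, 0 ≤ x) ∧
      ∀ k ≤ n + 1, sigM M k = s.esymm k := by
  have hH := hM.isHermitian
  have hr0 : (0 : ℝ) ∈ M.charpoly.roots := by
    rw [Polynomial.mem_roots (Matrix.charpoly_monic M).ne_zero, Polynomial.IsRoot,
      ← Polynomial.coeff_zero_eq_eval_zero]
    have := Matrix.det_eq_sign_charpoly_coeff M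
    rw [hdet] at this
    rcases mul_eq_zero.1 this.symm with h | h
    · simp at h
    · exact h
  obtain ⟨s, hs⟩ := Multiset.exists_cons_of_mem hr0
  have hc : M.charpoly.roots.card = n + 1 := by
    rw [hH.roots_charpoly_eq_eigenvalues]; simp
  refine ⟨s, ?_, ?_, ?_⟩
  · rw [hs] at hc; simpa using hc
  · intro x hx
    have : x ∈ M.charpoly.roots := hs ▸ Multiset.mem_cons_of_mem hx
    rw [hH.roots_charpoly_eq_eigenvalues] at this
    obtain ⟨i, -, rfl⟩ := Multiset.mem_map.1 this
    exact hM.eigenvalues_nonneg i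
  · intro k hk
    rw [sigM_eq_esymm_roots hH k hk, hs]
    rcases k with _ | k
    · simp [esymm_zero']
    · simp [esymm_cons_succ]

/-- normalised -/
noncomputable def pM {n : ℕ} (M : Matrix (Fin (n + 1)) (Fin (n + 1)) ℝ) (k : ℕ) : ℝ :=
  if k ≤ n then sigM M k / (n.choose k : ℝ) else 0

lemma pM_newtonSeq {n : ℕ} {M : Matrix (Fin (n + 1)) (Fin (n + 1)) ℝ} (hM : M.PosSemidef)
    (hdet : M.det = 0) : NewtonSeq (pM M) := by
  obtain ⟨s, hc, hs, he⟩ := sigM_multiset hM hdet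
  have : pM M = pnorm s := by
    ext k
    by_cases hk : k ≤ n
    · simp [pM, hk, pnorm, he k (by omega), hc]
    · simp only [pM, hk, if_false]
      rw [pnorm_of_lt _ _ (by omega)]
  rw [this]
  exact pnorm_newtonSeq s hs

/-- the rank one update -/
lemma det_rank_one {n : ℕ} (M : Matrix (Fin (n + 1)) (Fin (n + 1)) ℝ) (hM : M.IsHermitian)
    (x v : Fin (n + 1) → ℝ) (hx : M.mulVec x = 0) (s b : ℝ) :
    (1 + s • M + b • Matrix.vecMulVec v x).det = (1 + b * (v ⬝ᵥ x)) * (1 + s • M).det := by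
  have hT : M.transpose = M := by simpa using hM.eq
  have h1 : Matrix.vecMul x M = 0 := by
    rw [← Matrix.mulVec_transpose, hT, hx]
  have h2 : 1 + s • M + b • Matrix.vecMulVec v x =
      (1 + Matrix.vecMulVec (b • v) x) * (1 + s • M) := by
    rw [add_mul, mul_add, mul_add, Matrix.mul_smul, Matrix.mul_smul, Matrix.vecMulVec_mul _ _ M, h1]
    simp [Matrix.smul_vecMulVec]
  rw [h2, Matrix.det_mul]
  congr 1
  rw [Matrix.vecMulVec_eq Unit, Matrix.det_one_add_replicateCol_mul_replicateRow]
  simp [dotProduct_comm]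

end part2

section part3
open MeasureTheory Metric

lemma integral_det_const {E : Type*} [NormedAddCommGroup E] [InnerProductSpace ℝ E]
    [FiniteDimensional ℝ E] [MeasurableSpace E] [BorelSpace E]
    (g : E → E) (hg : ContDiff ℝ 1 g) (hgc : HasCompactSupport g) (R : ℝ)
    (hR : ∀ x, x ∉ ball (0 : E) R → g x = 0) :
    ∃ ε > 0, ∀ t : ℝ, 0 ≤ t → t < ε →
      ∫ x in ball (0 : E) R, (1 + t • fderiv ℝ g x).det = (volume : Measure E).real (ball 0 R) := by
  obtain ⟨K, hK⟩ := hg.lipschitzWith_of_hasCompactSupport hgc (by simp)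
  have hdc : Continuous (fun B : E →L[ℝ] E => B.det) := ContinuousLinearMap.continuous_det
  have hd1 : (1 : E →L[ℝ] E).det = 1 := by simp [ContinuousLinearMap.det]
  have hpos : ∀ᶠ B in nhds (1 : E →L[ℝ] E), 0 < B.det := by
    refine hdc.continuousAt.eventually (p := fun y => 0 < y) ?_
    simp only [hd1]
    exact lt_mem_nhds one_pos
  obtain ⟨δ, hδ, hδp⟩ := Metric.eventually_nhds_iff.1 hpos
  have hK1 : (0 : ℝ) < K + 1 := by positivity
  refine ⟨min (1 / (K + 1)) (δ / (K + 1)), by positivity, ?_⟩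
  intro t ht htε
  have ht1 : t * (K + 1) < 1 := (lt_div_iff₀ hK1).1 (htε.trans_le (min_le_left _ _))
  have ht2 : t * (K + 1) < δ := (lt_div_iff₀ hK1).1 (htε.trans_le (min_le_right _ _))
  have htK : t * K < 1 := by nlinarith
  set f : E → E := fun x => x + t • g x with hf
  have hgd : Differentiable ℝ g := hg.differentiable (by simp)
  have hfd : ∀ x, HasFDerivAt f (1 + t • fderiv ℝ g x) x := fun x =>
    (hasFDerivAt_id x).add ((hgd x).hasFDerivAt.const_smul t)
  have happ : ApproximatesLinearOn f ((ContinuousLinearEquiv.refl ℝ E : E ≃L[ℝ] E) : E →L[ℝ] E)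
      Set.univ (t.toNNReal * K) := by
    intro x _ y _
    have : f x - f y - ((ContinuousLinearEquiv.refl ℝ E : E ≃L[ℝ] E) : E →L[ℝ] E) (x - y) =
      t • (g x - g y) := by
      simp [hf, smul_sub]; abel
    rw [this, norm_smul, Real.norm_of_nonneg ht, NNReal.coe_mul, Real.coe_toNNReal t ht, mul_assoc]
    refine mul_le_mul_of_nonneg_left ?_ ht
    simpa [dist_eq_norm] using hK.dist_le_mul x y
  have hc : Subsingleton E ∨ t.toNNReal * K <
      ‖((ContinuousLinearEquiv.refl ℝ E).symm : E →L[ℝ] E)‖₊⁻¹ := by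
    rcases subsingleton_or_nontrivial E with h | h
    · exact Or.inl h
    · right
      have h1 : ‖((ContinuousLinearEquiv.refl ℝ E).symm : E →L[ℝ] E)‖₊ = 1 := by
        have : ((ContinuousLinearEquiv.refl ℝ E).symm : E →L[ℝ] E) = ContinuousLinearMap.id ℝ E := rfl
        rw [this, ← NNReal.coe_inj]
        simp
      rw [h1, inv_one, ← NNReal.coe_lt_coe, NNReal.coe_mul, Real.coe_toNNReal t ht]
      simpa using htK
  have hinj : Function.Injective f := Set.injOn_univ.1 (happ.injOn hc)
  have hsurj : Function.Surjective f := happ.surjective hc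
  have hout : ∀ x, x ∉ ball (0 : E) R → f x = x := fun x hx => by simp [hf, hR x hx]
  have himg : f '' ball (0 : E) R = ball 0 R := by
    ext y
    constructor
    · rintro ⟨x, hx, rfl⟩
      by_contra hy
      have := hinj (hout _ hy)
      rw [this] at hy
      exact hy hx
    · intro hy
      obtain ⟨x, rfl⟩ := hsurj y
      refine ⟨x, ?_, rfl⟩
      by_contra hx
      rw [hout x hx] at hy
      exact hx hy
  have key := integral_image_eq_integral_abs_det_fderiv_smul (volume : Measure E)
    (measurableSet_ball (x := (0 : E)) (ε := R)) (fun x _ => (hfd x).hasFDerivWithinAt) hinj.injOn (fun _ => (1 : ℝ))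
  rw [himg] at key
  simp only [integral_const, smul_eq_mul, mul_one, MeasurableSet.univ, measureReal_restrict_apply,
    Set.univ_inter] at key
  rw [key]
  refine setIntegral_congr_fun measurableSet_ball fun x _ => ?_
  have : 0 < (1 + t • fderiv ℝ g x).det := by
    apply hδp
    have h1 : ‖fderiv ℝ g x‖ ≤ K := norm_fderiv_le_of_lipschitz ℝ hK
    rw [dist_eq_norm, add_sub_cancel_left, norm_smul, Real.norm_of_nonneg ht]
    nlinarith [norm_nonneg (fderiv ℝ g x)]
  exact (abs_of_pos this).symm

end part3

section part4
open MeasureTheory Metric Set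

lemma polar_integral {E : Type*} [NormedAddCommGroup E] [InnerProductSpace ℝ E] [Nontrivial E]
    [FiniteDimensional ℝ E] [MeasurableSpace E] [BorelSpace E] (d : ℕ)
    (hd : Module.finrank ℝ E - 1 = d) (f Q : E → ℝ) (ρ : ℝ → ℝ)
    (hf : ∀ s : ℝ, 0 < s → ∀ θ : E, ‖θ‖ = 1 → f (s • θ) = ρ s * Q θ) :
    ∫ x, f x = (∫ θ : sphere (0 : E) 1, Q θ ∂(volume : Measure E).toSphere) *
      ∫ s in Ioi (0 : ℝ), s ^ d * ρ s := by
  calc ∫ x, f x = ∫ x : ({(0)}ᶜ : Set E), f x.1 ∂((volume : Measure E).comap (↑)) := by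
        rw [integral_subtype_comap (measurableSet_singleton _).compl fun x ↦ f x,
          restrict_compl_singleton]
    _ = ∫ x, Q x.1 * ρ x.2 ∂(volume : Measure E).toSphere.prod (.volumeIoiPow (Module.finrank ℝ E - 1)) := by
        rw [← (volume : Measure E).measurePreserving_homeomorphUnitSphereProd.integral_comp
          (Homeomorph.measurableEmbedding _)]
        refine integral_congr_ae (Filter.Eventually.of_forall fun x => ?_)
        have hx : (x : E) ≠ 0 := x.2
        have hx' : 0 < ‖(x : E)‖ := norm_pos_iff.2 hx
        have h1 := hf ‖(x : E)‖ hx' (‖(x : E)‖⁻¹ • (x : E)) (by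
          rw [norm_smul, norm_inv, norm_norm, inv_mul_cancel₀ hx'.ne'])
        rw [smul_inv_smul₀ hx'.ne'] at h1
        simp only [homeomorphUnitSphereProd_apply_snd_coe, homeomorphUnitSphereProd_apply_fst_coe]
        rw [h1, mul_comm]
    _ = (∫ θ : sphere (0 : E) 1, Q θ ∂(volume : Measure E).toSphere) *
        ∫ x : Ioi (0 : ℝ), ρ x ∂.volumeIoiPow (Module.finrank ℝ E - 1) :=
      integral_prod_mul (fun θ : sphere (0 : E) 1 => Q θ) (fun s : Ioi (0 : ℝ) => ρ s)
    _ = _ := by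
      rw [hd]
      congr 1
      simp only [Measure.volumeIoiPow, ENNReal.ofReal]
      rw [integral_withDensity_eq_integral_smul,
        integral_subtype_comap measurableSet_Ioi fun a ↦ Real.toNNReal (a ^ d) • ρ a,
        setIntegral_congr_fun measurableSet_Ioi fun x hx ↦ ?_]
      · rw [NNReal.smul_def, Real.coe_toNNReal _ (pow_nonneg hx.out.le _), smul_eq_mul]
      · exact (measurable_subtype_coe.pow_const _).real_toNNReal

lemma coeff_eq_of_eval (m : ℕ) (a b : ℕ → ℝ) (ε : ℝ) (hε : 0 < ε)
    (h : ∀ t : ℝ, 0 ≤ t → t < ε → ∑ k ∈ Finset.range m, t ^ k * a k =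
      ∑ k ∈ Finset.range m, t ^ k * b k) : ∀ k < m, a k = b k := by
  have key : (∑ k ∈ Finset.range m, Polynomial.C (a k) * Polynomial.X ^ k) =
      (∑ k ∈ Finset.range m, Polynomial.C (b k) * Polynomial.X ^ k) := by
    refine Polynomial.eq_of_infinite_eval_eq _ _ ((Ioo_infinite hε).mono ?_)
    intro t ht
    have := h t ht.1.le ht.2
    simp only [mem_setOf_eq, Polynomial.eval_finset_sum, Polynomial.eval_mul, Polynomial.eval_C,
      Polynomial.eval_pow, Polynomial.eval_X]
    simpa only [mul_comm] using this
  intro k hk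
  have := congrArg (fun p => Polynomial.coeff p k) key
  simpa [Polynomial.finset_sum_coeff, Polynomial.coeff_C_mul, Polynomial.coeff_X_pow, hk] using this

lemma sigM_smul {n : ℕ} (M : Matrix (Fin (n + 1)) (Fin (n + 1)) ℝ) (c : ℝ) (k : ℕ)
    (hk : k < n + 2) : sigM (c • M) k = c ^ k * sigM M k := by
  refine coeff_eq_of_eval (n + 2) (fun k => sigM (c • M) k) (fun k => c ^ k * sigM M k) 1 one_pos
    ?_ k hk
  intro t _ _
  have h1 := det_one_add_eq_sum_sigM (c • M) t
  have h2 := det_one_add_eq_sum_sigM M (t * c)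
  rw [smul_smul] at h1
  rw [← h1, h2]
  refine Finset.sum_congr rfl fun k _ => ?_
  ring

/-- the radial cutoff -/
noncomputable def cutB : ContDiffBump (2 : ℝ) := ⟨1 / 2, 1, by norm_num, by norm_num⟩

lemma cutB_zero {s : ℝ} (h : s ≤ 1 ∨ 3 ≤ s) : cutB s = 0 := by
  apply cutB.zero_of_le_dist
  rw [Real.dist_eq]
  show (1 : ℝ) ≤ _
  rcases h with h | h
  · rw [abs_of_nonpos (by linarith)]; linarith
  · rw [abs_of_nonneg (by linarith)]; linarith

lemma cutB_contDiff : ContDiff ℝ 2 (cutB : ℝ → ℝ) := cutB.contDiff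

lemma cutB_deriv_zero {s : ℝ} (h : s ≤ 1 ∨ 3 ≤ s) : deriv cutB s = 0 := by
  have hmin : IsLocalMin (cutB : ℝ → ℝ) s := by
    refine Filter.Eventually.of_forall fun y => ?_
    rw [cutB_zero h]; exact cutB.nonneg
  exact hmin.deriv_eq_zero

lemma cutB_deriv_cont : Continuous (deriv cutB) := cutB_contDiff.continuous_deriv (by norm_num)

lemma radial_pos (k m : ℕ) : 0 < ∫ s in Ioi (0 : ℝ), s ^ m * (cutB (s ^ 2)) ^ (k + 1) := by
  have hcont : Continuous fun s : ℝ => s ^ m * (cutB (s ^ 2)) ^ (k + 1) := by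
    have := cutB_contDiff.continuous
    fun_prop
  have hcs : HasCompactSupport fun s : ℝ => s ^ m * (cutB (s ^ 2)) ^ (k + 1) := by
    refine HasCompactSupport.intro (isCompact_Icc (a := -2) (b := 2)) fun s hs => ?_
    have : 3 ≤ s ^ 2 := by
      by_contra! h
      exact hs ⟨by nlinarith, by nlinarith⟩
    rw [cutB_zero (Or.inr this)]; simp
  have hIntg := hcont.integrable_of_hasCompactSupport (μ := volume) hcs
  rw [setIntegral_pos_iff_support_of_nonneg_ae]
  · have : Ioo (1.3 : ℝ) 1.5 ⊆ (Function.support fun s : ℝ => s ^ m * (cutB (s ^ 2)) ^ (k + 1)) ∩ Ioi 0 := by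
      intro s hs
      have h0 : (0 : ℝ) < s := by linarith [hs.1]
      refine ⟨?_, h0⟩
      have : 0 < cutB (s ^ 2) := by
        apply cutB.pos_of_mem_ball
        rw [mem_ball, Real.dist_eq, abs_lt]
        show - (1 : ℝ) < _ ∧ _ < (1 : ℝ)
        constructor <;> nlinarith [hs.1, hs.2]
      show s ^ m * (cutB (s ^ 2)) ^ (k + 1) ≠ 0
      positivity
    refine lt_of_lt_of_le ?_ (measure_mono this)
    rw [Real.volume_Ioo]; norm_num
  · refine (ae_restrict_iff' measurableSet_Ioi).2 (Filter.Eventually.of_forall fun s hs => ?_)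
    have : 0 ≤ cutB (s ^ 2) := cutB.nonneg
    have : (0 : ℝ) < s := hs
    positivity
  · exact hIntg.integrableOn

/-- integration by parts in the radial variable -/
lemma radial_ibp (k m : ℕ) :
    ((k : ℝ) + 1) * (∫ s in Ioi (0 : ℝ), s ^ (m + 1) * ((cutB (s ^ 2)) ^ k * (2 * deriv cutB (s ^ 2) * s)))
      = - ((m : ℝ) + 1) * ∫ s in Ioi (0 : ℝ), s ^ m * (cutB (s ^ 2)) ^ (k + 1) := by
  have hc := cutB_contDiff.continuous
  have hd := cutB_deriv_cont
  have hcs : ∀ F : ℝ → ℝ, (∀ s, 3 ≤ s ^ 2 → F s = 0) → HasCompactSupport F := fun F hF => by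
    refine HasCompactSupport.intro (isCompact_Icc (a := -2) (b := 2)) fun s hs => hF s ?_
    by_contra! h
    exact hs ⟨by nlinarith, by nlinarith⟩
  set f1 : ℝ → ℝ := fun s => s ^ (m + 1) * ((cutB (s ^ 2)) ^ k * (2 * deriv cutB (s ^ 2) * s)) with hf1
  set f2 : ℝ → ℝ := fun s => s ^ m * (cutB (s ^ 2)) ^ (k + 1) with hf2
  have i1 : Integrable f1 := by
    refine Continuous.integrable_of_hasCompactSupport (by rw [hf1]; fun_prop) (hcs _ fun s hs => ?_)
    simp [hf1, cutB_deriv_zero (Or.inr hs)]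
  have i2 : Integrable f2 := by
    refine Continuous.integrable_of_hasCompactSupport (by rw [hf2]; fun_prop) (hcs _ fun s hs => ?_)
    simp [hf2, cutB_zero (Or.inr hs)]
  have hder : ∀ s : ℝ, HasDerivAt (fun s : ℝ => s ^ (m + 1) * (cutB (s ^ 2)) ^ (k + 1))
      (((k : ℝ) + 1) * f1 s + ((m : ℝ) + 1) * f2 s) s := by
    intro s
    have e1 : HasDerivAt (fun s : ℝ => cutB (s ^ 2)) (deriv cutB (s ^ 2) * (2 * s)) s := by
      have a1 : HasDerivAt (cutB : ℝ → ℝ) (deriv cutB (s ^ 2)) (s ^ 2) :=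
        (cutB_contDiff.differentiable (by norm_num) (s ^ 2)).hasDerivAt
      have a2 : HasDerivAt (fun s : ℝ => s ^ 2) (2 * s) s := by simpa using hasDerivAt_pow 2 s
      exact HasDerivAt.comp (h₂ := (cutB : ℝ → ℝ)) (h := fun s : ℝ => s ^ 2) s a1 a2
    have e2 := (hasDerivAt_pow (m + 1) s).mul (e1.pow (k + 1))
    refine e2.congr_deriv ?_
    simp only [hf1, hf2, Nat.add_sub_cancel, Pi.pow_apply]
    push_cast
    ring
  have h0 : ∫ s in Ioi (0 : ℝ), (((k : ℝ) + 1) * f1 s + ((m : ℝ) + 1) * f2 s) = 0 - 0 := by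
    have := integral_Ioi_of_hasDerivAt_of_tendsto'
      (f := fun s : ℝ => s ^ (m + 1) * (cutB (s ^ 2)) ^ (k + 1)) (a := 0) (m := 0)
      (fun s _ => hder s) ((i1.const_mul _).add (i2.const_mul _)).integrableOn ?_
    · rw [this]; simp
    · refine tendsto_const_nhds.congr' ?_
      filter_upwards [Filter.eventually_ge_atTop (2 : ℝ)] with s hs
      rw [cutB_zero (Or.inr (by nlinarith))]; simp
  rw [integral_add (i1.const_mul _).integrableOn (i2.const_mul _).integrableOn,
    integral_const_mul, integral_const_mul] at h0
  linarith

end part4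

section part5
open MeasureTheory Metric
open scoped RealInnerProductSpace

section calcu
variable {n : ℕ} {u : Esp n → ℝ}

lemma u_cda (hu : ContDiffOn ℝ 2 u {(0 : Esp n)}ᶜ) {x : Esp n} (hx : x ≠ 0) :
    ContDiffAt ℝ 2 u x :=
  (hu x hx).contDiffAt (isOpen_compl_singleton.mem_nhds hx)

lemma u_fd_cda (hu : ContDiffOn ℝ 2 u {(0 : Esp n)}ᶜ) {x : Esp n} (hx : x ≠ 0) :
    ContDiffAt ℝ 1 (fderiv ℝ u) x :=
  (u_cda hu hx).fderiv_right (by norm_num)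

lemma u_diff (hu : ContDiffOn ℝ 2 u {(0 : Esp n)}ᶜ) {x : Esp n} (hx : x ≠ 0) :
    DifferentiableAt ℝ u x := (u_cda hu hx).differentiableAt (by norm_num)

lemma u_fd_diff (hu : ContDiffOn ℝ 2 u {(0 : Esp n)}ᶜ) {x : Esp n} (hx : x ≠ 0) :
    DifferentiableAt ℝ (fderiv ℝ u) x := (u_fd_cda hu hx).differentiableAt (by norm_num)

lemma fd_hom (hhom : PosHom n u) {r : ℝ} (hr : 0 < r) (x : Esp n) :
    fderiv ℝ u (r • x) = fderiv ℝ u x := by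
  have h1 : (fun y => u (r • y)) = fun y => r • u y := by
    funext y; exact hhom r hr y
  have h2 := fderiv_comp_smul (𝕜 := ℝ) (f := u) r (x := x)
  have h3 : fderiv ℝ (fun y => r • u y) x = r • fderiv ℝ u x :=
    congrFun (fderiv_const_smul_field (𝕜 := ℝ) (f := u) r) x
  rw [h1, h3] at h2
  exact (smul_right_injective _ hr.ne' h2).symm

lemma euler (hu : ContDiffOn ℝ 2 u {(0 : Esp n)}ᶜ) (hhom : PosHom n u) {x : Esp n} (hx : x ≠ 0) :
    fderiv ℝ u x x = u x := by
  have h0 : HasDerivAt (fun t : ℝ => t • x) x 1 := by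
    simpa using (hasDerivAt_id (1 : ℝ)).smul_const x
  have h1 : HasDerivAt (fun t : ℝ => u (t • x)) (fderiv ℝ u x x) 1 := by
    have := (u_diff hu hx).hasFDerivAt
    rw [← one_smul ℝ x] at this
    have h3 := HasFDerivAt.comp_hasDerivAt (1 : ℝ) this h0
    rw [one_smul] at h3
    exact h3
  have h2 : HasDerivAt (fun t : ℝ => t * u x) (u x) 1 := by
    simpa using (hasDerivAt_id (1 : ℝ)).mul_const (u x)
  refine h1.unique (h2.congr_of_eventuallyEq ?_)
  filter_upwards [lt_mem_nhds (zero_lt_one (α := ℝ))] with t ht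
  exact hhom t ht x

/-- second derivative -/
def D2 (u : Esp n → ℝ) (x : Esp n) : Esp n →L[ℝ] Esp n →L[ℝ] ℝ := fderiv ℝ (fderiv ℝ u) x

lemma D2_radial (hu : ContDiffOn ℝ 2 u {(0 : Esp n)}ᶜ) (hhom : PosHom n u) {x : Esp n}
    (hx : x ≠ 0) : D2 u x x = 0 := by
  have h0 : HasDerivAt (fun t : ℝ => t • x) x 1 := by
    simpa using (hasDerivAt_id (1 : ℝ)).smul_const x
  have h1 : HasDerivAt (fun t : ℝ => fderiv ℝ u (t • x)) (D2 u x x) 1 := by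
    have := (u_fd_diff hu hx).hasFDerivAt
    rw [← one_smul ℝ x] at this
    have h3 := HasFDerivAt.comp_hasDerivAt (1 : ℝ) this h0
    rw [one_smul] at h3
    exact h3
  refine h1.unique ((hasDerivAt_const (1 : ℝ) (fderiv ℝ u x)).congr_of_eventuallyEq ?_)
  filter_upwards [lt_mem_nhds (zero_lt_one (α := ℝ))] with t ht
  exact fd_hom hhom ht x

lemma D2_hom (hhom : PosHom n u) {r : ℝ} (hr : 0 < r) (x : Esp n) :
    D2 u (r • x) = r⁻¹ • D2 u x := by
  have h1 : (fun y => fderiv ℝ u (r • y)) = fderiv ℝ u := by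
    funext y; exact fd_hom hhom hr y
  have h2 := fderiv_comp_smul (𝕜 := ℝ) (f := fderiv ℝ u) r (x := x)
  rw [h1] at h2
  rw [D2, D2, h2, smul_smul, inv_mul_cancel₀ hr.ne', one_smul]

lemma D2_symm (hu : ContDiffOn ℝ 2 u {(0 : Esp n)}ᶜ) {x : Esp n} (hx : x ≠ 0) (v w : Esp n) :
    D2 u x v w = D2 u x w v :=
  ((u_cda hu hx).isSymmSndFDerivAt (by simp)) v w

lemma hessForm_eq (hu : ContDiffOn ℝ 2 u {(0 : Esp n)}ᶜ) {x : Esp n} (hx : x ≠ 0) (v w : Esp n) :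
    hessForm n u x v w = D2 u x v w := by
  have h := (u_fd_diff hu hx).hasFDerivAt
  have h2 := ((ContinuousLinearMap.apply ℝ ℝ w).hasFDerivAt (x := fderiv ℝ u x)).comp x h
  have h3 : HasFDerivAt (fun y => fderiv ℝ u y w) ((ContinuousLinearMap.apply ℝ ℝ w).comp (D2 u x)) x := h2
  rw [hessForm, h3.fderiv]; rfl

lemma D2_cont (hu : ContDiffOn ℝ 2 u {(0 : Esp n)}ᶜ) {x : Esp n} (hx : x ≠ 0) :
    ContinuousAt (D2 u) x :=
  ((u_fd_cda hu hx).fderiv_right (m := 0) (by norm_num)).continuousAt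

/-- Hessian matrix, via D2 -/
def HM (u : Esp n → ℝ) (x : Esp n) : Matrix (Fin (n + 1)) (Fin (n + 1)) ℝ :=
  Matrix.of fun i j => D2 u x (EuclideanSpace.single i 1) (EuclideanSpace.single j 1)

lemma hessMatrix_eq (hu : ContDiffOn ℝ 2 u {(0 : Esp n)}ᶜ) {x : Esp n} (hx : x ≠ 0) :
    hessMatrix n u x = HM u x := by
  ext i j
  simp [hessMatrix, HM, hessForm_eq hu hx]

lemma esp_sum (w : Esp n) : w = ∑ j, w j • EuclideanSpace.single j (1 : ℝ) := by
  ext i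
  simp [Pi.single_apply]

lemma HM_mulVec (x w : Esp n) (i : Fin (n + 1)) :
    (HM u x).mulVec w i = D2 u x (EuclideanSpace.single i 1) w := by
  conv_rhs => rw [esp_sum w]
  simp only [map_sum, map_smul, Matrix.mulVec, dotProduct, HM, Matrix.of_apply, smul_eq_mul]
  refine Finset.sum_congr rfl fun j _ => ?_
  ring

lemma HM_quad (x v w : Esp n) : (v : Fin (n + 1) → ℝ) ⬝ᵥ (HM u x).mulVec w = D2 u x v w := by
  conv_rhs => rw [esp_sum v]
  simp only [map_sum, map_smul, dotProduct, HM_mulVec, smul_eq_mul,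
    ContinuousLinearMap.sum_apply, ContinuousLinearMap.smul_apply]

lemma HM_isHermitian (hu : ContDiffOn ℝ 2 u {(0 : Esp n)}ᶜ) {x : Esp n} (hx : x ≠ 0) :
    (HM u x).IsHermitian := by
  ext i j
  simp only [HM, Matrix.conjTranspose_apply, Matrix.of_apply, star_trivial]
  exact D2_symm hu hx _ _

lemma HM_radial (hu : ContDiffOn ℝ 2 u {(0 : Esp n)}ᶜ) (hhom : PosHom n u) {x : Esp n}
    (hx : x ≠ 0) : (HM u x).mulVec x = 0 := by
  funext i
  rw [HM_mulVec, D2_symm hu hx, D2_radial hu hhom hx]; simp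

lemma HM_hom (hhom : PosHom n u) {r : ℝ} (hr : 0 < r) (x : Esp n) :
    HM u (r • x) = r⁻¹ • HM u x := by
  ext i j
  simp [HM, D2_hom hhom hr]

lemma HM_det (hu : ContDiffOn ℝ 2 u {(0 : Esp n)}ᶜ) (hhom : PosHom n u) {x : Esp n}
    (hx : x ≠ 0) : (HM u x).det = 0 := by
  refine Matrix.exists_mulVec_eq_zero_iff.1 ⟨x, fun h => hx ?_, HM_radial hu hhom hx⟩
  ext i; exact congrFun h i

lemma HM_psd (hu : ContDiffOn ℝ 2 u {(0 : Esp n)}ᶜ)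
    (hconv : ∀ x ∈ sphere (0 : Esp n) 1, ∀ v : Esp n, 0 ≤ hessForm n u x v v)
    {x : Esp n} (hx : x ∈ sphere (0 : Esp n) 1) : (HM u x).PosSemidef := by
  have hx0 : x ≠ 0 := by rintro rfl; simp at hx
  refine Matrix.PosSemidef.of_dotProduct_mulVec_nonneg (HM_isHermitian hu hx0) fun v => ?_
  have := HM_quad (u := u) x (WithLp.toLp 2 v) (WithLp.toLp 2 v)
  have h2 := hconv x hx (WithLp.toLp 2 v)
  rw [hessForm_eq hu hx0] at h2
  simpa using this ▸ h2

lemma HM_cont (hu : ContDiffOn ℝ 2 u {(0 : Esp n)}ᶜ) : ContinuousOn (HM u) {(0 : Esp n)}ᶜ := by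
  intro x hx
  refine ContinuousAt.continuousWithinAt ?_
  have h := D2_cont hu hx
  refine continuousAt_pi.2 fun i => continuousAt_pi.2 fun j => ?_
  exact (h.clm_apply continuousAt_const).clm_apply continuousAt_const

lemma charpoly_coeff_cont (k : ℕ) :
    Continuous fun M : Matrix (Fin (n + 1)) (Fin (n + 1)) ℝ => M.charpoly.coeff k := by
  have h : ∀ M : Matrix (Fin (n + 1)) (Fin (n + 1)) ℝ, M.charpoly.coeff k =
      MvPolynomial.eval (fun p : Fin (n + 1) × Fin (n + 1) => M p.1 p.2)
        ((Matrix.charpoly.univ ℝ (Fin (n + 1))).coeff k) := fun M =>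
    (Matrix.charpoly.univ_coeff_eval₂Hom _ (RingHom.id ℝ)
      (fun p : Fin (n + 1) × Fin (n + 1) => M p.1 p.2) k).symm
  simp only [h]
  refine (MvPolynomial.continuous_eval _).comp ?_
  fun_prop

lemma sigM_cont (hu : ContDiffOn ℝ 2 u {(0 : Esp n)}ᶜ) (k : ℕ) :
    ContinuousOn (fun x => sigM (HM u x) k) {(0 : Esp n)}ᶜ := by
  have : Continuous fun M : Matrix (Fin (n + 1)) (Fin (n + 1)) ℝ => sigM M k :=
    continuous_const.mul (charpoly_coeff_cont _)
  exact this.comp_continuousOn (HM_cont hu)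

end calcu

end part5

section part6
open MeasureTheory Metric
open scoped RealInnerProductSpace

section mink
variable {n : ℕ} {u : Esp n → ℝ}

lemma cut_cont {φ : ℝ → ℝ} (hφ : Continuous φ) (h0 : ∀ s, s ≤ 1 → φ s = 0) {Q : Esp n → ℝ}
    (hQ : ContinuousOn Q {(0 : Esp n)}ᶜ) : Continuous fun x => φ (‖x‖ ^ 2) * Q x := by
  rw [continuous_iff_continuousAt]
  intro x
  by_cases hx : x = 0
  · subst hx
    refine (continuousAt_const (y := (0 : ℝ))).congr ?_
    filter_upwards [ball_mem_nhds (0 : Esp n) one_pos] with y hy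
    rw [mem_ball_zero_iff] at hy
    rw [h0 _ (by nlinarith [norm_nonneg y])]; simp
  · exact ((hφ.comp (continuous_norm.pow 2)).continuousAt).mul
      (hQ.continuousAt (isOpen_compl_singleton.mem_nhds hx))

/-- gradient in coordinates -/
def gv (u : Esp n → ℝ) (x : Esp n) : Esp n :=
  ∑ i, (fderiv ℝ u x (EuclideanSpace.single i 1)) • EuclideanSpace.single i (1 : ℝ)

lemma gv_apply (x : Esp n) (i : Fin (n + 1)) :
    gv u x i = fderiv ℝ u x (EuclideanSpace.single i 1) := by
  simp [gv, Pi.single_apply]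

lemma gv_dot (x v : Esp n) : (gv u x : Fin (n + 1) → ℝ) ⬝ᵥ v = fderiv ℝ u x v := by
  conv_rhs => rw [esp_sum v]
  simp only [map_sum, map_smul, dotProduct, gv_apply, smul_eq_mul]
  refine Finset.sum_congr rfl fun j _ => ?_
  ring

lemma gv_cda (hu : ContDiffOn ℝ 2 u {(0 : Esp n)}ᶜ) {x : Esp n} (hx : x ≠ 0) :
    ContDiffAt ℝ 1 (gv u) x := by
  unfold gv
  refine ContDiffAt.sum fun i _ => ?_
  exact ((u_fd_cda hu hx).clm_apply contDiffAt_const).smul contDiffAt_const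

lemma gv_fderiv (hu : ContDiffOn ℝ 2 u {(0 : Esp n)}ᶜ) {x : Esp n} (hx : x ≠ 0)
    (v : Esp n) (i : Fin (n + 1)) :
    fderiv ℝ (gv u) x v i = D2 u x v (EuclideanSpace.single i 1) := by
  have h1 : HasFDerivAt (gv u) (fderiv ℝ (gv u) x) x :=
    ((gv_cda hu hx).differentiableAt (by norm_num)).hasFDerivAt
  have h2 : HasFDerivAt (fun y => gv u y i)
      ((EuclideanSpace.proj (𝕜 := ℝ) i).comp (fderiv ℝ (gv u) x)) x :=
    (ContinuousLinearMap.hasFDerivAt (EuclideanSpace.proj (𝕜 := ℝ) i : Esp n →L[ℝ] ℝ)).comp x h1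
  have h3 : (fun y => gv u y i) = fun y => fderiv ℝ u y (EuclideanSpace.single i 1) := by
    funext y; exact gv_apply y i
  rw [h3] at h2
  have h4 := hessForm_eq hu hx v (EuclideanSpace.single i 1)
  rw [hessForm, h2.fderiv] at h4
  exact h4

/-- cut off gradient field -/
def gf (u : Esp n → ℝ) (x : Esp n) : Esp n := cutB (‖x‖ ^ 2) • gv u x

lemma gf_contDiff (hu : ContDiffOn ℝ 2 u {(0 : Esp n)}ᶜ) : ContDiff ℝ 1 (gf u) := by
  rw [contDiff_iff_contDiffAt]
  intro x
  by_cases hx : x = 0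
  · subst hx
    refine (contDiffAt_const (c := (0 : Esp n))).congr_of_eventuallyEq ?_
    filter_upwards [ball_mem_nhds (0 : Esp n) one_pos] with y hy
    rw [mem_ball_zero_iff] at hy
    rw [gf, cutB_zero (Or.inl (by nlinarith [norm_nonneg y])), zero_smul]
  · have h1 : ContDiff ℝ 1 (cutB : ℝ → ℝ) := cutB_contDiff.of_le (by norm_num)
    exact ((h1.comp (contDiff_norm_sq ℝ)).contDiffAt).smul (gv_cda hu hx)

lemma gf_zero (x : Esp n) (hx : x ∉ ball (0 : Esp n) 2) : gf u x = 0 := by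
  rw [mem_ball_zero_iff, not_lt] at hx
  rw [gf, cutB_zero (Or.inr (by nlinarith)), zero_smul]

lemma gf_det (hu : ContDiffOn ℝ 2 u {(0 : Esp n)}ᶜ) (hhom : PosHom n u) {x : Esp n} (hx : x ≠ 0)
    (t : ℝ) : (1 + t • fderiv ℝ (gf u) x).det =
      (1 + t * (2 * deriv cutB (‖x‖ ^ 2)) * u x) *
        ∑ k ∈ Finset.range (n + 2), (t * cutB (‖x‖ ^ 2)) ^ k * sigM (HM u x) k := by
  rw [← det_one_add_eq_sum_sigM]
  have h1 : HasFDerivAt (fun y : Esp n => cutB (‖y‖ ^ 2))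
      ((deriv cutB (‖x‖ ^ 2)) • ((2 : ℝ) • innerSL ℝ x)) x := by
    have a1 : HasDerivAt (cutB : ℝ → ℝ) (deriv cutB (‖x‖ ^ 2)) (‖x‖ ^ 2) :=
      (cutB_contDiff.differentiable (by norm_num) _).hasDerivAt
    have a2 : HasFDerivAt (fun y : Esp n => ‖y‖ ^ 2) ((2 : ℝ) • innerSL ℝ x) x := by
      have := (hasStrictFDerivAt_norm_sq x).hasFDerivAt
      have e : (2 : ℝ) • innerSL ℝ x = (2 : ℕ) • innerSL ℝ x := by
        rw [← Nat.cast_smul_eq_nsmul ℝ]; norm_num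
      rw [e]; exact this
    exact HasDerivAt.comp_hasFDerivAt (h₂ := (cutB : ℝ → ℝ)) (f := fun y : Esp n => ‖y‖ ^ 2) x a1 a2
  have h2 : HasFDerivAt (gf u) _ x :=
    h1.smul ((gv_cda hu hx).differentiableAt (by norm_num)).hasFDerivAt
  rw [h2.fderiv]
  have h3 : ∀ A : Esp n →L[ℝ] Esp n, A.det =
      (LinearMap.toMatrix (EuclideanSpace.basisFun (Fin (n + 1)) ℝ).toBasis
        (EuclideanSpace.basisFun (Fin (n + 1)) ℝ).toBasis (A : Esp n →ₗ[ℝ] Esp n)).det := fun A => by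
    rw [LinearMap.det_toMatrix, ContinuousLinearMap.det]
  rw [h3]
  have h4 := det_rank_one (HM u x) (HM_isHermitian hu hx) x (gv u x) (HM_radial hu hhom hx)
    (t * cutB (‖x‖ ^ 2)) (t * (2 * deriv cutB (‖x‖ ^ 2)))
  rw [gv_dot, euler hu hhom hx] at h4
  rw [← h4]
  congr 1
  ext i j
  have h5 : (fderiv ℝ (gv u) x (EuclideanSpace.single j 1)) i = HM u x i j := by
    rw [gv_fderiv hu hx, D2_symm hu hx]; rfl
  have h6 : inner ℝ x (EuclideanSpace.single j (1 : ℝ)) = x j := by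
    simp [EuclideanSpace.inner_single_right]
  simp [LinearMap.toMatrix_apply, Matrix.one_apply, Matrix.vecMulVec_apply, h5, h6]
  ring

lemma sigM_zero (M : Matrix (Fin (n + 1)) (Fin (n + 1)) ℝ) : sigM M 0 = 1 := by
  have := det_one_add_eq_sum_sigM M 0
  rw [Finset.sum_range_succ'] at this
  simpa using this.symm

lemma flux_coeff (hu : ContDiffOn ℝ 2 u {(0 : Esp n)}ᶜ) (hhom : PosHom n u) (k : ℕ)
    (hk : k < n + 1) :
    (∫ x : Esp n, cutB (‖x‖ ^ 2) ^ (k + 1) * sigM (HM u x) (k + 1)) +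
      ∫ x : Esp n, cutB (‖x‖ ^ 2) ^ k * (2 * deriv cutB (‖x‖ ^ 2)) * (u x * sigM (HM u x) k) = 0 := by
  have hc := cutB_contDiff.continuous
  have hd := cutB_deriv_cont
  have huc : ContinuousOn u {(0 : Esp n)}ᶜ := hu.continuousOn
  have hF : ∀ k, Continuous fun x : Esp n => cutB (‖x‖ ^ 2) ^ k * sigM (HM u x) k := by
    intro k
    rcases k with _ | k
    · simp only [sigM_zero, pow_zero]; fun_prop
    · refine cut_cont (φ := fun s => cutB s ^ (k + 1)) (by fun_prop) ?_ (sigM_cont hu _)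
      intro s hs
      simp [cutB_zero (Or.inl hs)]
  have hG : ∀ k, Continuous fun x : Esp n =>
      cutB (‖x‖ ^ 2) ^ k * (2 * deriv cutB (‖x‖ ^ 2)) * (u x * sigM (HM u x) k) := by
    intro k
    refine cut_cont (φ := fun s => cutB s ^ k * (2 * deriv cutB s)) (by fun_prop) ?_
      (huc.mul (sigM_cont hu _))
    intro s hs
    simp [cutB_deriv_zero (Or.inl hs)]
  have hIntg : ∀ f : Esp n → ℝ, Continuous f → IntegrableOn f (ball (0 : Esp n) 2) := fun f hf =>
    (hf.continuousOn.integrableOn_compact (isCompact_closedBall 0 2)).mono_set ball_subset_closedBall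
  set A : ℕ → ℝ := fun k => ∫ x in ball (0 : Esp n) 2, cutB (‖x‖ ^ 2) ^ k * sigM (HM u x) k with hA
  set B : ℕ → ℝ := fun k => ∫ x in ball (0 : Esp n) 2,
    cutB (‖x‖ ^ 2) ^ k * (2 * deriv cutB (‖x‖ ^ 2)) * (u x * sigM (HM u x) k) with hB
  have hgc : HasCompactSupport (gf u) :=
    HasCompactSupport.intro (isCompact_closedBall (0 : Esp n) 2) fun x hx =>
      gf_zero x fun h => hx (ball_subset_closedBall h)
  obtain ⟨ε, hε, hdet⟩ := integral_det_const (gf u) (gf_contDiff hu) hgc 2 gf_zero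
  set V := (volume : Measure (Esp n)).real (ball 0 2)
  have key : A (k + 1) + B k = 0 := by
    have := coeff_eq_of_eval (n + 3)
      (fun k => (if k < n + 2 then A k else 0) + (if k = 0 then 0 else B (k - 1)))
      (fun k => if k = 0 then V else 0) ε hε ?_ (k + 1) (by omega)
    · simpa [show k < n + 1 from hk] using this
    · intro t ht0 ht
      have e1 := hdet t ht0 ht
      have e2 : ∫ x in ball (0 : Esp n) 2, (1 + t • fderiv ℝ (gf u) x).det =
          ∫ x in ball (0 : Esp n) 2, ∑ k ∈ Finset.range (n + 2),
            (t ^ k * (cutB (‖x‖ ^ 2) ^ k * sigM (HM u x) k) + t ^ (k + 1) *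
              (cutB (‖x‖ ^ 2) ^ k * (2 * deriv cutB (‖x‖ ^ 2)) * (u x * sigM (HM u x) k))) := by
        refine integral_congr_ae (ae_restrict_of_ae ?_)
        filter_upwards [compl_mem_ae_iff.2 (measure_singleton (μ := volume) (0 : Esp n))] with x hx
        rw [gf_det hu hhom hx, Finset.mul_sum]
        refine Finset.sum_congr rfl fun k _ => ?_
        rw [mul_pow]; ring
      have e5 : ∀ k ∈ Finset.range (n + 2), Integrable (fun x : Esp n =>
            (t ^ k * (cutB (‖x‖ ^ 2) ^ k * sigM (HM u x) k) + t ^ (k + 1) *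
              (cutB (‖x‖ ^ 2) ^ k * (2 * deriv cutB (‖x‖ ^ 2)) * (u x * sigM (HM u x) k))))
            (volume.restrict (ball (0 : Esp n) 2)) := fun k _ =>
        ((hIntg _ (hF k)).const_mul _).add ((hIntg _ (hG k)).const_mul _)
      rw [e2, integral_finsetSum _ e5] at e1
      have e3 : ∑ k ∈ Finset.range (n + 2), (t ^ k * A k + t ^ (k + 1) * B k) = V := by
        rw [← e1]
        refine Finset.sum_congr rfl fun k _ => ?_
        rw [integral_add ((hIntg _ (hF k)).const_mul _) ((hIntg _ (hG k)).const_mul _),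
          integral_const_mul, integral_const_mul]
      have e4 : ∑ k ∈ Finset.range (n + 3), t ^ k * (if k = 0 then V else 0) = V := by
        rw [Finset.sum_range_succ']; simp
      rw [e4, ← e3, Finset.sum_add_distrib]
      simp only [mul_add]
      rw [Finset.sum_add_distrib]
      congr 1
      · rw [Finset.sum_range_succ]
        simp only [lt_irrefl, if_false, mul_zero, add_zero]
        refine Finset.sum_congr rfl fun k hk => ?_
        rw [if_pos (Finset.mem_range.1 hk)]
      · rw [Finset.sum_range_succ']
        simp
  have c1 : A (k + 1) = ∫ x : Esp n, cutB (‖x‖ ^ 2) ^ (k + 1) * sigM (HM u x) (k + 1) := by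
    refine setIntegral_eq_integral_of_forall_compl_eq_zero fun x hx => ?_
    rw [mem_ball_zero_iff, not_lt] at hx
    rw [cutB_zero (Or.inr (by nlinarith))]; simp
  have c2 : B k = ∫ x : Esp n, cutB (‖x‖ ^ 2) ^ k * (2 * deriv cutB (‖x‖ ^ 2)) *
      (u x * sigM (HM u x) k) := by
    refine setIntegral_eq_integral_of_forall_compl_eq_zero fun x hx => ?_
    rw [mem_ball_zero_iff, not_lt] at hx
    rw [cutB_deriv_zero (Or.inr (by nlinarith))]; simp
  rw [← c1, ← c2]; exact key

lemma minkowski (hu : ContDiffOn ℝ 2 u {(0 : Esp n)}ᶜ) (hhom : PosHom n u) (k m : ℕ)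
    (hk : k + 1 + m = n) :
    ((k : ℝ) + 1) * (∫ θ : sphere (0 : Esp n) 1, sigM (HM u θ) (k + 1) ∂(volume : Measure (Esp n)).toSphere)
    = ((m : ℝ) + 1) * ∫ θ : sphere (0 : Esp n) 1, u θ * sigM (HM u θ) k ∂(volume : Measure (Esp n)).toSphere := by
  have h0 := flux_coeff hu hhom k (by omega)
  have hfin : Module.finrank ℝ (Esp n) - 1 = n := by simp
  rw [polar_integral n hfin _ (fun x => sigM (HM u x) (k + 1))
      (fun s => cutB (s ^ 2) ^ (k + 1) * (s⁻¹) ^ (k + 1)) ?_,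
    polar_integral n hfin _ (fun x => u x * sigM (HM u x) k)
      (fun s => cutB (s ^ 2) ^ k * (2 * deriv cutB (s ^ 2) * s) * (s⁻¹) ^ k) ?_] at h0
  · have r1 : ∫ s in Set.Ioi (0 : ℝ), s ^ n * (cutB (s ^ 2) ^ (k + 1) * (s⁻¹) ^ (k + 1)) =
        ∫ s in Set.Ioi (0 : ℝ), s ^ m * (cutB (s ^ 2)) ^ (k + 1) := by
      refine setIntegral_congr_fun measurableSet_Ioi fun s hs => ?_
      have hs : s ≠ 0 := (ne_of_gt hs)
      have : s ^ (k + 1) * (s⁻¹) ^ (k + 1) = 1 := by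
        rw [← mul_pow, mul_inv_cancel₀ hs, one_pow]
      show _ = _
      rw [← hk, pow_add]
      linear_combination (s ^ m * (cutB (s ^ 2)) ^ (k + 1)) * this
    have r2 : ∫ s in Set.Ioi (0 : ℝ), s ^ n * (cutB (s ^ 2) ^ k * (2 * deriv cutB (s ^ 2) * s) * (s⁻¹) ^ k) =
        ∫ s in Set.Ioi (0 : ℝ), s ^ (m + 1) * ((cutB (s ^ 2)) ^ k * (2 * deriv cutB (s ^ 2) * s)) := by
      refine setIntegral_congr_fun measurableSet_Ioi fun s hs => ?_
      have hs : s ≠ 0 := (ne_of_gt hs)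
      have : s ^ k * (s⁻¹) ^ k = 1 := by
        rw [← mul_pow, mul_inv_cancel₀ hs, one_pow]
      show _ = _
      rw [← hk, show k + 1 + m = k + (m + 1) by ring, pow_add]
      linear_combination (s ^ (m + 1) * ((cutB (s ^ 2)) ^ k * (2 * deriv cutB (s ^ 2) * s))) * this
    rw [r1, r2] at h0
    have h1 := radial_ibp k m
    have h2 := radial_pos k m
    refine mul_right_cancel₀ h2.ne' ?_
    linear_combination ((k : ℝ) + 1) * h0 -
      (∫ θ : sphere (0 : Esp n) 1, u θ * sigM (HM u θ) k ∂(volume : Measure (Esp n)).toSphere) * h1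
  · intro s hs θ hθ
    rw [norm_smul, hθ, Real.norm_of_nonneg hs.le, mul_one, HM_hom hhom hs, hhom s hs,
      sigM_smul _ _ _ (by omega)]
    ring
  · intro s hs θ hθ
    rw [norm_smul, hθ, Real.norm_of_nonneg hs.le, mul_one, HM_hom hhom hs,
      sigM_smul _ _ _ (by omega)]
    ring

end mink

end part6

section part7
open MeasureTheory Metric
open scoped RealInnerProductSpace

section abstr
variable {X : Type*} [TopologicalSpace X] [CompactSpace X] [PreconnectedSpace X] [MeasurableSpace X]
  [BorelSpace X] {μ : Measure X} [IsFiniteMeasure μ] [μ.IsOpenPosMeasure]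

lemma int_cont {f : X → ℝ} (hf : Continuous f) : Integrable f μ :=
  hf.integrable_of_hasCompactSupport (HasCompactSupport.of_compactSpace f)

lemma eq_zero_of_int {f : X → ℝ} (hf : Continuous f) (h0 : ∀ x, 0 ≤ f x)
    (h : ∫ x, f x ∂μ ≤ 0) : ∀ x, f x = 0 := by
  have h1 : ∫ x, f x ∂μ = 0 := le_antisymm h (integral_nonneg h0)
  rw [integral_eq_zero_iff_of_nonneg h0 (int_cont hf)] at h1
  have := (Continuous.ae_eq_iff_eq μ hf continuous_const).1 h1
  exact fun x => congrFun this x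

lemma abstract_core [Nonempty X] (P : ℕ → X → ℝ) (U : X → ℝ) (hP : ∀ k, Continuous (P k))
    (hU : Continuous U) (hUpos : ∀ x, 0 < U x) (hN : ∀ x, NewtonSeq (fun k => P k x)) (n : ℕ)
    (hM : ∀ k, k + 1 ≤ n → ∫ x, P (k + 1) x ∂μ = ∫ x, U x * P k x ∂μ)
    (a : ℕ → ℝ) (ha : ∀ k, 0 ≤ a k) (J : ℕ) (hJ : J + 1 ≤ n) (haJ : 0 < a (J + 1)) (c : ℝ)
    (hc : ∀ x, ∑ k ∈ Finset.range (J + 2), a k * P k x = c) :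
    ∃ r > 0, ∀ x, P 1 x = r := by
  have hP0 : ∀ x, P 0 x = 1 := fun x => (hN x).1
  have hPn : ∀ k x, 0 ≤ P k x := fun k x => (hN x).2.1 k
  -- some point has `P (J+1) > 0`
  have hpos : ∃ x, 0 < P (J + 1) x := by
    by_contra! hno
    have hdown : ∀ i, i ≤ J + 1 → ∀ x, P (J + 1 - i) x = 0 := by
      intro i
      induction i with
      | zero => intro _ x; exact le_antisymm (hno x) (hPn _ x)
      | succ i ih =>
        intro hi
        have h1 := ih (by omega)
        have h2 := hM (J + 1 - (i + 1)) (by omega)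
        rw [show J + 1 - (i + 1) + 1 = J + 1 - i by omega] at h2
        simp only [h1, integral_zero] at h2
        have h3 := eq_zero_of_int (μ := μ) (hU.mul (hP (J + 1 - (i + 1))))
          (fun x => mul_nonneg (hUpos x).le (hPn _ x)) h2.symm.le
        intro x
        exact (mul_eq_zero.1 (h3 x)).resolve_left (hUpos x).ne'
    obtain ⟨x⟩ := ‹Nonempty X›
    have := hdown (J + 1) le_rfl x
    rw [Nat.sub_self, hP0] at this
    exact one_ne_zero this
  obtain ⟨x0, hx0⟩ := hpos
  have hca : a 0 < c := by
    rw [← hc x0, Finset.sum_range_succ, Finset.sum_range_succ', hP0]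
    have h1 : 0 ≤ ∑ k ∈ Finset.range J, a (k + 1) * P (k + 1) x0 :=
      Finset.sum_nonneg fun k _ => mul_nonneg (ha _) (hPn _ _)
    have h2 := mul_pos haJ hx0
    linarith
  -- choose r
  obtain ⟨r, hr, hrc⟩ : ∃ r > 0, ∑ k ∈ Finset.range (J + 2), a k * r ^ k = c := by
    have hcont : Continuous fun r : ℝ => ∑ k ∈ Finset.range (J + 2), a k * r ^ k := by fun_prop
    set R := max 1 (c / a (J + 1))
    have hR1 : 1 ≤ R := le_max_left _ _
    have hF0 : ∑ k ∈ Finset.range (J + 2), a k * (0 : ℝ) ^ k = a 0 := by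
      rw [Finset.sum_range_succ']; simp
    have hFR : c ≤ ∑ k ∈ Finset.range (J + 2), a k * R ^ k := by
      have h1 : a (J + 1) * R ^ (J + 1) ≤ ∑ k ∈ Finset.range (J + 2), a k * R ^ k :=
        Finset.single_le_sum (f := fun k => a k * R ^ k)
          (fun k _ => mul_nonneg (ha k) (by positivity)) (by simp)
      have h2 : c ≤ a (J + 1) * R := by
        have := le_max_right 1 (c / a (J + 1))
        rw [div_le_iff₀ haJ] at this
        linarith
      have h3 : R ≤ R ^ (J + 1) := le_self_pow₀ hR1 (by omega)
      nlinarith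
    have := intermediate_value_Icc (show (0 : ℝ) ≤ R by linarith) hcont.continuousOn
    obtain ⟨r, hr, hrc⟩ := this ⟨by rw [hF0]; exact hca.le, hFR⟩
    refine ⟨r, lt_of_le_of_ne hr.1 ?_, hrc⟩
    rintro rfl
    simp only [hF0] at hrc
    linarith
  have heq : ∀ x, ∑ k ∈ Finset.range (J + 1 + 1), a k * P k x =
      ∑ k ∈ Finset.range (J + 1 + 1), a k * r ^ k := fun x => (hc x).trans hrc.symm
  have hge : ∀ x, r ≤ P 1 x := fun x => newton_one_ge (hN x) ha (by omega) haJ hr (heq x)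
  have htop : ∀ x, P (J + 1) x ≤ r * P J x := fun x => newton_top_le (hN x) ha haJ hr (heq x)
  -- certificate
  set S : X → ℝ := fun x => ∑ k ∈ Finset.range (J + 1), a k * P k x with hS
  set S' : X → ℝ := fun x => ∑ k ∈ Finset.range (J + 1), a k * P (k + 1) x with hS'
  have hSc : ∀ x, S x + a (J + 1) * P (J + 1) x = c := fun x => by
    rw [← hc x, Finset.sum_range_succ _ (J + 1)]
  have hSS : ∀ x, S' x ≤ S x * P 1 x := fun x => by
    simp only [hS, hS', Finset.sum_mul]
    refine Finset.sum_le_sum fun k _ => ?_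
    have := mul_le_mul_of_nonneg_left (newton_step (hN x) k) (ha k)
    linarith
  have hScont : Continuous S := by simp only [hS]; fun_prop
  have hS'cont : Continuous S' := by simp only [hS']; fun_prop
  have hPc1 := hP 1
  have hPcJ := hP J
  have hPcJ1 := hP (J + 1)
  have int1 : ∫ x, (S' x + r * a (J + 1) * P (J + 1) x - c * P 1 x) ∂μ =
      ∫ x, U x * (S x + r * a (J + 1) * P J x - c) ∂μ := by
    have e1 : ∫ x, S' x ∂μ = ∫ x, U x * S x ∂μ := by
      have : ∀ x, U x * S x = ∑ k ∈ Finset.range (J + 1), a k * (U x * P k x) := fun x => by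
        simp only [hS, Finset.mul_sum]
        exact Finset.sum_congr rfl fun k _ => by ring
      simp only [this, hS']
      rw [integral_finsetSum, integral_finsetSum]
      · refine Finset.sum_congr rfl fun k hk => ?_
        rw [integral_const_mul, integral_const_mul, hM k (by have := Finset.mem_range.1 hk; omega)]
      · intro k _
        have := hP k
        exact int_cont (by fun_prop)
      · intro k _
        have := hP k
        exact int_cont (by fun_prop)
    have e2 := hM J hJ
    have e3 := hM 0 (by omega)
    simp only [hP0, mul_one, zero_add] at e3
    have lhs : ∫ x, (S' x + r * a (J + 1) * P (J + 1) x - c * P 1 x) ∂μ =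
        ∫ x, S' x ∂μ + r * a (J + 1) * ∫ x, P (J + 1) x ∂μ - c * ∫ x, P 1 x ∂μ := by
      rw [integral_sub, integral_add, integral_const_mul, integral_const_mul]
      all_goals exact int_cont (by fun_prop)
    have rhs : ∫ x, U x * (S x + r * a (J + 1) * P J x - c) ∂μ =
        ∫ x, U x * S x ∂μ + r * a (J + 1) * ∫ x, U x * P J x ∂μ - c * ∫ x, U x ∂μ := by
      have : ∀ x, U x * (S x + r * a (J + 1) * P J x - c) =
          U x * S x + r * a (J + 1) * (U x * P J x) - c * U x := fun x => by ring
      simp only [this]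
      rw [integral_sub, integral_add, integral_const_mul, integral_const_mul]
      all_goals exact int_cont (by fun_prop)
    rw [lhs, rhs, e1, e2, e3]
  have int2 : 0 ≤ ∫ x, U x * (S x + r * a (J + 1) * P J x - c) ∂μ := by
    refine integral_nonneg fun x => mul_nonneg (hUpos x).le ?_
    have h1 := mul_le_mul_of_nonneg_left (htop x) haJ.le
    have := hSc x
    linarith
  have hprod : ∀ x, P (J + 1) x * (P 1 x - r) = 0 := by
    refine eq_zero_of_int (μ := μ) (by fun_prop)
      (fun x => mul_nonneg (hPn _ x) (by linarith [hge x])) ?_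
    have h1 : a (J + 1) * ∫ x, P (J + 1) x * (P 1 x - r) ∂μ ≤
        - ∫ x, (S' x + r * a (J + 1) * P (J + 1) x - c * P 1 x) ∂μ := by
      rw [← integral_const_mul, ← integral_neg]
      refine integral_mono (int_cont (by fun_prop)) (int_cont (by fun_prop)) fun x => ?_
      have h2 := hSS x
      have h3 : S x = c - a (J + 1) * P (J + 1) x := by linarith [hSc x]
      rw [h3] at h2
      show a (J + 1) * (P (J + 1) x * (P 1 x - r)) ≤
        - (S' x + r * a (J + 1) * P (J + 1) x - c * P 1 x)
      linarith
    rw [int1] at h1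
    by_contra! h
    have := mul_pos haJ h
    linarith
  have hdich : ∀ x, 0 < P (J + 1) x → P 1 x = r ∧ P (J + 1) x = r ^ (J + 1) := by
    intro x hx
    have h1 : P 1 x = r := by
      have := (mul_eq_zero.1 (hprod x)).resolve_left hx.ne'
      linarith
    exact ⟨h1, newton_top_eq (hN x) ha haJ (heq x) h1⟩
  have hclopen : IsClopen {x | 0 < P (J + 1) x} := by
    constructor
    · have : {x | 0 < P (J + 1) x} = {x | P (J + 1) x = r ^ (J + 1)} := by
        ext x
        simp only [Set.mem_ofPred_eq]
        exact ⟨fun h => (hdich x h).2, fun h => by rw [h]; positivity⟩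
      rw [this]
      exact isClosed_eq (hP _) continuous_const
    · exact isOpen_lt continuous_const (hP _)
  have huniv := hclopen.eq_univ ⟨x0, hx0⟩
  refine ⟨r, hr, fun x => (hdich x ?_).1⟩
  have : x ∈ {x | 0 < P (J + 1) x} := huniv ▸ Set.mem_univ x
  simpa only [Set.mem_ofPred_eq] using this

lemma abstract_two (P : ℕ → X → ℝ) (U : X → ℝ) (hP : ∀ k, Continuous (P k))
    (hN : ∀ x, NewtonSeq (fun k => P k x))
    (hM0 : ∫ x, P 1 x ∂μ = ∫ x, U x * P 0 x ∂μ) (hM1 : ∫ x, P 2 x ∂μ = ∫ x, U x * P 1 x ∂μ)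
    (r : ℝ) (h1 : ∀ x, P 1 x = r) : ∀ x, P 2 x = r ^ 2 := by
  have hP0 : ∀ x, P 0 x = 1 := fun x => (hN x).1
  have hc := hP 2
  have h := eq_zero_of_int (μ := μ) (f := fun x => r ^ 2 - P 2 x) (by fun_prop)
    (fun x => by have := newton_pow (hN x) 2; simp only [h1] at this; linarith) ?_
  · intro x; linarith [h x]
  · rw [integral_sub (int_cont (by fun_prop)) (int_cont (by fun_prop)), hM1]
    simp only [h1, hP0, mul_one] at hM0 ⊢
    rw [integral_mul_const, ← hM0, integral_const, integral_const]
    simp only [smul_eq_mul]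
    linarith
end abstr

lemma matrix_rigid {n : ℕ} (M : Matrix (Fin (n + 1)) (Fin (n + 1)) ℝ) (hM : M.IsHermitian)
    (x : Fin (n + 1) → ℝ) (hx : M.mulVec x = 0) (hxx : x ⬝ᵥ x = 1) (r : ℝ)
    (h1 : M.trace = n * r) (h2 : (M * M).trace = n * r ^ 2) :
    M = r • (1 - Matrix.vecMulVec x x) := by
  have hMt : M.transpose = M := by
    rw [← Matrix.conjTranspose_eq_transpose_of_trivial]; exact hM
  have hxM : Matrix.vecMul x M = 0 := by rw [← Matrix.mulVec_transpose, hMt, hx]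
  set D := M - r • (1 - Matrix.vecMulVec x x) with hD
  have hDt : D.transpose = D := by
    simp [hD, hMt, Matrix.transpose_vecMulVec]
  have e1 : M * Matrix.vecMulVec x x = 0 := by
    rw [Matrix.mul_vecMulVec, hx, Matrix.zero_vecMulVec]
  have e2 : Matrix.vecMulVec x x * M = 0 := by
    rw [Matrix.vecMulVec_mul, hxM, Matrix.vecMulVec_zero]
  have e3 : Matrix.vecMulVec x x * Matrix.vecMulVec x x = Matrix.vecMulVec x x := by
    rw [Matrix.vecMulVec_mul_vecMulVec, hxx]; simp
  have e4 : (Matrix.vecMulVec x x).trace = 1 := by rw [Matrix.trace_vecMulVec, hxx]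
  have hDD : D * D = M * M - (2 * r) • M + r ^ 2 • (1 - Matrix.vecMulVec x x) := by
    simp only [hD, mul_sub, sub_mul, Matrix.mul_smul, Matrix.smul_mul, e1, e2, e3, mul_one, one_mul,
      smul_sub, smul_smul]
    module
  have htr : (D * D).trace = 0 := by
    rw [hDD]
    simp only [Matrix.trace_add, Matrix.trace_sub, Matrix.trace_smul, h1, h2, e4, Matrix.trace_one,
      Fintype.card_fin, smul_eq_mul]
    push_cast
    ring
  have hD0 : D = 0 := by
    have : (D.conjTranspose * D).trace = 0 := by
      rw [Matrix.conjTranspose_eq_transpose_of_trivial, hDt, htr]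
    exact Matrix.trace_conjTranspose_mul_self_eq_zero_iff.1 this
  exact sub_eq_zero.1 hD0

end part7

section part8
open MeasureTheory Metric
open scoped RealInnerProductSpace

section fin
variable {n : ℕ} {u : Esp n → ℝ}

lemma dot_eq_inner (x v : Esp n) : (x : Fin (n + 1) → ℝ) ⬝ᵥ v = inner ℝ x v := by
  rw [PiLp.inner_apply, dotProduct]
  refine Finset.sum_congr rfl fun i _ => ?_
  simp [mul_comm]

lemma hasFDerivAt_norm_aux {x : Esp n} (hx : x ≠ 0) :
    HasFDerivAt (fun y : Esp n => ‖y‖) (‖x‖⁻¹ • innerSL ℝ x) x := by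
  have h1 := (hasStrictFDerivAt_norm_sq x).hasFDerivAt
  have h2 := h1.sqrt (by positivity)
  have h3 : (fun y : Esp n => Real.sqrt (‖y‖ ^ 2)) = fun y => ‖y‖ := by
    funext y; exact Real.sqrt_sq (norm_nonneg y)
  rw [h3, Real.sqrt_sq (norm_nonneg x)] at h2
  refine h2.congr_fderiv ?_
  rw [← Nat.cast_smul_eq_nsmul ℝ, smul_smul]
  congr 1
  push_cast
  have : ‖x‖ ≠ 0 := norm_ne_zero_iff.2 hx
  field_simp

lemma const_grad (hn : 1 ≤ n) (hu : ContDiffOn ℝ 2 u {(0 : Esp n)}ᶜ) (hhom : PosHom n u) (r : ℝ)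
    (hH : ∀ x ∈ sphere (0 : Esp n) 1, HM u x = r • (1 - Matrix.vecMulVec x x)) (w : Esp n)
    {x y : Esp n} (hx : x ≠ 0) (hy : y ≠ 0) :
    fderiv ℝ u x w - r * (‖x‖⁻¹ * inner ℝ x w) = fderiv ℝ u y w - r * (‖y‖⁻¹ * inner ℝ y w) := by
  have hder : ∀ z : Esp n, z ≠ 0 →
      HasFDerivAt (fun z => fderiv ℝ u z w - r * (‖z‖⁻¹ * inner ℝ z w)) (0 : Esp n →L[ℝ] ℝ) z := by
    intro z hz
    have hz' : 0 < ‖z‖ := norm_pos_iff.2 hz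
    have h1 : HasFDerivAt (fun y => fderiv ℝ u y w)
        ((ContinuousLinearMap.apply ℝ ℝ w).comp (D2 u z)) z :=
      ((ContinuousLinearMap.apply ℝ ℝ w).hasFDerivAt (x := fderiv ℝ u z)).comp z
        (u_fd_diff hu hz).hasFDerivAt
    have h2 : HasFDerivAt (fun y : Esp n => ‖y‖⁻¹) _ z :=
      (hasDerivAt_inv hz'.ne').comp_hasFDerivAt z (hasFDerivAt_norm_aux hz)
    have h3 : HasFDerivAt (fun y : Esp n => inner ℝ y w) (innerSL ℝ w) z := by
      have := (innerSL ℝ w).hasFDerivAt (x := z)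
      refine this.congr_of_eventuallyEq (Filter.Eventually.of_forall fun y => ?_)
      simp [real_inner_comm]
    have h4 := h1.sub ((h2.mul h3).const_mul r)
    refine h4.congr_fderiv ?_
    ext v
    have hθ : ‖z‖⁻¹ • z ∈ sphere (0 : Esp n) 1 := by
      rw [mem_sphere_zero_iff_norm, norm_smul, norm_inv, norm_norm, inv_mul_cancel₀ hz'.ne']
    have h5 : D2 u z v w = ‖z‖⁻¹ * (r * (inner ℝ v w - inner ℝ v (‖z‖⁻¹ • z) * inner ℝ (‖z‖⁻¹ • z) w)) := by
      have a1 : HM u z = ‖z‖⁻¹ • HM u (‖z‖⁻¹ • z) := by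
        rw [← HM_hom hhom hz', smul_inv_smul₀ hz'.ne']
      rw [← HM_quad, a1, hH _ hθ, ← dot_eq_inner, ← dot_eq_inner, ← dot_eq_inner]
      simp only [Matrix.smul_mulVec, Matrix.sub_mulVec, Matrix.one_mulVec, dotProduct_smul,
        dotProduct_sub, Matrix.vecMulVec_mulVec, smul_eq_mul]
      simp
    simp [h5, inner_smul_left, inner_smul_right, real_inner_comm]
    field_simp
    ring
  have hrank : 1 < Module.rank ℝ (Esp n) := by
    apply Module.lt_rank_of_lt_finrank
    simp; omega
  exact isOpen_compl_singleton.is_const_of_fderiv_eq_zero (𝕜 := ℝ)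
    (f := fun z => fderiv ℝ u z w - r * (‖z‖⁻¹ * inner ℝ z w))
    (isConnected_compl_singleton_of_one_lt_rank hrank (0 : Esp n)).isPreconnected
    (fun z hz => (hder z hz).differentiableAt.differentiableWithinAt)
    (fun z hz => (hder z hz).fderiv) hx hy

end fin


end part8

/-- Firey's question, even isotropic case.  If `α_0,…,α_n ≥ 0` with at least
two positive, `c > 0`, and `0 < u ∈ C²(𝕊ⁿ)` is an even, convex solution of
`Σ_k α_k σ_k(∇̄²u + ḡu, ḡ) = c` on `𝕊ⁿ`, then `u` is constant; i.e. the only even, smooth,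
convex bodies whose kinematic measure density `Σ_k α_k σ_k` is a positive constant are
origin-centred balls. -/
theorem statement_1 (n : ℕ) (hn : 1 ≤ n)
    (α : ℕ → ℝ) (hα0 : ∀ k, 0 ≤ α k) (hαsupp : ∀ k, n < k → α k = 0)
    (hαtwo : ∃ i j, i < j ∧ j ≤ n ∧ 0 < α i ∧ 0 < α j)
    (c : ℝ) (hc : 0 < c)
    (u : Esp n → ℝ)
    (hu : ContDiffOn ℝ 2 u {(0 : Esp n)}ᶜ)
    (hhom : PosHom n u)
    (hupos : ∀ x ∈ sphere (0 : Esp n) 1, 0 < u x)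
    (heven : ∀ x ∈ sphere (0 : Esp n) 1, u (-x) = u x)
    (hconv : ∀ x ∈ sphere (0 : Esp n) 1, ∀ v : Esp n, 0 ≤ hessForm n u x v v)
    (heq : ∀ x ∈ sphere (0 : Esp n) 1,
      ∑ k ∈ Finset.range (n + 1), α k * sigmaElem n k u x = c) :
    ∃ r : ℝ, 0 < r ∧ ∀ x ∈ sphere (0 : Esp n) 1, u x = r := by
  have hne : ∀ x ∈ sphere (0 : Esp n) 1, x ≠ 0 := by
    rintro x hx rfl; simp at hx
  have hrank : 1 < Module.rank ℝ (Esp n) := by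
    apply Module.lt_rank_of_lt_finrank
    simp; omega
  have hconn := isConnected_sphere hrank (0 : Esp n) (zero_le_one (α := ℝ))
  have : PreconnectedSpace (sphere (0 : Esp n) 1) := Subtype.preconnectedSpace hconn.isPreconnected
  have : Nonempty (sphere (0 : Esp n) 1) := hconn.nonempty.to_subtype
  -- top index
  obtain ⟨J, hJn, hJpos, hJtop⟩ : ∃ J, J + 1 ≤ n ∧ 0 < α (J + 1) ∧ ∀ k, J + 1 < k → α k = 0 := by
    obtain ⟨i, j, hij, hjn, _, hj⟩ := hαtwo
    classical
    set m := Nat.findGreatest (fun k => 0 < α k) n with hm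
    have h1 : j ≤ m := Nat.le_findGreatest hjn hj
    have h2 : 0 < α m := Nat.findGreatest_spec (P := fun k => 0 < α k) hjn hj
    have h3 : m ≤ n := Nat.findGreatest_le n
    refine ⟨m - 1, by omega, by rwa [Nat.sub_add_cancel (by omega)], fun k hk => ?_⟩
    rcases le_or_gt k n with hkn | hkn
    · have := Nat.findGreatest_is_greatest (P := fun k => 0 < α k) (n := n) (k := k) (by omega) hkn
      exact le_antisymm (not_lt.1 this) (hα0 k)
    · exact hαsupp k hkn
  set P : ℕ → sphere (0 : Esp n) 1 → ℝ := fun k θ => pM (HM u θ) k with hP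
  set U : sphere (0 : Esp n) 1 → ℝ := fun θ => u θ with hU
  have hmaps : ∀ θ : sphere (0 : Esp n) 1, (θ : Esp n) ∈ ({(0 : Esp n)}ᶜ : Set (Esp n)) :=
    fun θ => hne θ θ.2
  have hUc : Continuous U := hu.continuousOn.comp_continuous continuous_subtype_val hmaps
  have hPc : ∀ k, Continuous (P k) := by
    intro k
    by_cases hk : k ≤ n
    · simp only [hP, pM, if_pos hk]
      exact ((sigM_cont hu k).comp_continuous continuous_subtype_val hmaps).div_const _
    · simp only [hP, pM, if_neg hk]; exact continuous_const
  have hN : ∀ θ, NewtonSeq (fun k => P k θ) := fun θ =>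
    pM_newtonSeq (HM_psd hu hconv θ.2) (HM_det hu hhom (hmaps θ))
  have hch : ∀ k, k ≤ n → (n.choose k : ℝ) ≠ 0 := fun k hk =>
    Nat.cast_ne_zero.2 (Nat.choose_pos hk).ne'
  have hM : ∀ k, k + 1 ≤ n → ∫ θ, P (k + 1) θ ∂(volume : Measure (Esp n)).toSphere =
      ∫ θ, U θ * P k θ ∂(volume : Measure (Esp n)).toSphere := by
    intro k hk
    obtain ⟨m, hm⟩ := Nat.exists_eq_add_of_le hk
    have h1 := minkowski hu hhom k m hm.symm
    simp only [hP, pM, if_pos hk, if_pos (show k ≤ n by omega), hU, ← mul_div_assoc]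
    rw [integral_div, integral_div, div_eq_div_iff (hch _ hk) (hch _ (by omega))]
    have h2 : (n.choose (k + 1) : ℝ) * (k + 1) = n.choose k * (m + 1) := by
      have := Nat.choose_succ_right_eq n k
      rw [show n - k = m + 1 by omega] at this
      exact_mod_cast this
    have hk1 : (k : ℝ) + 1 ≠ 0 := by positivity
    refine mul_left_cancel₀ hk1 ?_
    linear_combination (n.choose k : ℝ) * h1 -
      (∫ θ : sphere (0 : Esp n) 1, u θ * sigM (HM u θ) k ∂(volume : Measure (Esp n)).toSphere) * h2
  have hsum : ∀ θ, ∑ k ∈ Finset.range (J + 2), (α k * n.choose k) * P k θ = c := by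
    intro θ
    rw [← heq θ θ.2]
    have h1 : ∀ k ∈ Finset.range (n + 1), α k * sigmaElem n k u θ = (α k * n.choose k) * P k θ := by
      intro k hk
      have hk : k ≤ n := by have := Finset.mem_range.1 hk; omega
      have h2 : sigmaElem n k u θ = sigM (HM u θ) k := by
        rw [← hessMatrix_eq hu (hmaps θ)]; rfl
      have h3 := hch k hk
      rw [h2]
      simp only [hP, pM, if_pos hk]
      field_simp
    rw [Finset.sum_congr rfl h1]
    refine Finset.sum_subset (Finset.range_mono (by omega)) fun k _ hk => ?_
    rw [hJtop k (by rw [Finset.mem_range] at hk; omega)]; simp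
  obtain ⟨r, hr, h1⟩ := abstract_core (μ := (volume : Measure (Esp n)).toSphere) P U hPc hUc
    (fun θ => hupos θ θ.2) hN n hM (fun k => α k * n.choose k)
    (fun k => mul_nonneg (hα0 k) (Nat.cast_nonneg _)) J hJn
    (mul_pos hJpos (Nat.cast_pos.2 (Nat.choose_pos hJn))) c hsum
  have hH : ∀ x ∈ sphere (0 : Esp n) 1, HM u x = r • (1 - Matrix.vecMulVec x x) := by
    intro x hx
    have hx0 := hne x hx
    have hherm := HM_isHermitian hu hx0
    have hn0 : (n : ℝ) ≠ 0 := by positivity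
    have ht : (HM u x).trace = n * r := by
      have := h1 ⟨x, hx⟩
      simp only [hP, pM, if_pos hn, Nat.choose_one_right, sigM_one] at this
      field_simp at this
      linarith
    have hs2 : 2 * sigM (HM u x) 2 = n * (n - 1) * r ^ 2 := by
      rcases Nat.lt_or_ge 1 n with hn2 | hn2
      · have := abstract_two (μ := (volume : Measure (Esp n)).toSphere) P U hPc hN (hM 0 hn)
          (hM 1 hn2) r h1 ⟨x, hx⟩
        simp only [hP, pM, if_pos (show 2 ≤ n from hn2)] at this
        rw [div_eq_iff (hch 2 hn2), Nat.cast_choose_two] at this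
        rw [this]; ring
      · obtain ⟨s, hs, _, he⟩ := sigM_multiset (HM_psd hu hconv hx) (HM_det hu hhom hx0)
        have hn1 : n = 1 := by omega
        rw [he 2 (by omega), esymm_of_card_lt _ _ (by omega), hn1]
        simp
    refine matrix_rigid _ hherm x (HM_radial hu hhom hx0) ?_ r ht ?_
    · rw [dot_eq_inner, real_inner_self_eq_norm_sq, mem_sphere_zero_iff_norm.1 hx]; norm_num
    · have := two_sigM_two hn hherm
      rw [hs2, ht] at this
      linear_combination this
  refine ⟨r, hr, fun x hx => ?_⟩
  have hx0 := hne x hx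
  have hnx0 : -x ≠ 0 := neg_ne_zero.2 hx0
  have hnorm : ‖x‖ = 1 := mem_sphere_zero_iff_norm.1 hx
  have g := const_grad hn hu hhom r hH x hx0 hnx0
  have e1 := euler hu hhom hx0
  have e2 := euler hu hhom hnx0
  rw [map_neg] at e2
  have e3 := heven x hx
  rw [norm_neg, hnorm, inner_neg_left, real_inner_self_eq_norm_sq, hnorm] at g
  norm_num at g
  linarith
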